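/- arXiv:1902.10292 — 8 statements merged into one kernel-verified Lean document; each statement's English description precedes it below -/
import Mathlib

section
/- (Theorem 1, definiteness of AAO solutions) Let {S_1, …, S_M} be a solution set of the AAO coupled Riccati equations on an interval I = [t_f − δ, t_f] ⊆ [t_0, t_f] with 0 < δ ≤ t_f − t_0. Then for every t ∈ I, the matrix S_1(t) is negative definite and the matrices S_i(t) are positive semidefinite for i = 2, …, M. -/
open Matrix Set

/-- One-sided first-order condition at a minimum which is not the right endpoint. -/
theorem derivWithin_nonneg_of_isMinOn_Icc {f : ℝ → ℝ} {a b t d : ℝ} (ht : t ∈ Icc a b)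
    (htb : t < b) (hmin : IsMinOn f (Icc a b) t) (hd : HasDerivWithinAt f d (Icc a b) t) :
    0 ≤ d := by
  have hmem : b - t ∈ posTangentConeAt (Icc a b) t :=
    sub_mem_posTangentConeAt_of_segment_subset
      ((convex_Icc a b).segment_subset ht ⟨ht.1.trans htb.le, le_rfl⟩)
  have h := hmin.localize.hasFDerivWithinAt_nonneg hd.hasFDerivWithinAt hmem
  simp only [ContinuousLinearMap.toSpanSingleton_apply, smul_eq_mul] at h
  exact nonneg_of_mul_nonneg_right h (sub_pos.mpr htb)

theorem isCompact_setOf_dotProduct_self_eq_one {ι : Type*} [Fintype ι] :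
    IsCompact {v : ι → ℝ | v ⬝ᵥ v = 1} := by
  refine Metric.isCompact_of_isClosed_isBounded
    (isClosed_eq (Continuous.dotProduct continuous_id continuous_id) continuous_const) ?_
  refine (Metric.isBounded_closedBall (x := (0 : ι → ℝ)) (r := 1)).subset fun v hv => ?_
  rw [mem_closedBall_zero_iff, pi_norm_le_iff_of_nonneg zero_le_one]
  intro i
  have h : v i * v i ≤ v ⬝ᵥ v :=
    Finset.single_le_sum (f := fun i => v i * v i) (fun j _ => mul_self_nonneg (v j))
      (Finset.mem_univ i)
  rw [Real.norm_eq_abs, abs_le_one_iff_mul_self_le_one]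
  exact h.trans_eq hv

theorem posSemidef_of_isSymm {ι : Type*} [Fintype ι] {X : Matrix ι ι ℝ} (hX : X.IsSymm)
    (h : ∀ v : ι → ℝ, 0 ≤ v ⬝ᵥ X *ᵥ v) : X.PosSemidef :=
  .of_dotProduct_mulVec_nonneg (by rwa [IsHermitian, conjTranspose_eq_transpose_of_trivial])
    (by simpa using h)

/-- A quadratic form which is at least `c` on the unit sphere is at least
`c * (w ⬝ᵥ w)` at every vector `w`. -/
theorem mul_dotProduct_self_le_of_forall_unit_le {ι : Type*} [Fintype ι]
    {X : Matrix ι ι ℝ} {c : ℝ} (hc : ∀ v : ι → ℝ, v ⬝ᵥ v = 1 → c ≤ v ⬝ᵥ X *ᵥ v) (w : ι → ℝ) :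
    c * (w ⬝ᵥ w) ≤ w ⬝ᵥ X *ᵥ w := by
  rcases eq_or_ne w 0 with rfl | hw
  · simp
  have hpos : 0 < w ⬝ᵥ w := by simpa using dotProduct_star_self_pos_iff.mpr hw
  set r := √(w ⬝ᵥ w)
  have hr : 0 < r := Real.sqrt_pos.mpr hpos
  have hrr : r * r = w ⬝ᵥ w := Real.mul_self_sqrt hpos.le
  have h := hc (r⁻¹ • w) (by
    rw [smul_dotProduct, dotProduct_smul, ← hrr, smul_eq_mul, smul_eq_mul]
    field_simp)
  rw [mulVec_smul, smul_dotProduct, dotProduct_smul, smul_eq_mul, smul_eq_mul,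
    ← mul_assoc, ← mul_inv, hrr, inv_mul_eq_div, le_div_iff₀ hpos] at h
  exact h

/-- A symmetric matrix whose quadratic form is bounded below by `c` on the unit sphere has every
unit vector attaining `c` as an eigenvector. -/
theorem mulVec_eq_smul_of_forall_unit_le {ι : Type*} [Fintype ι] [DecidableEq ι]
    {X : Matrix ι ι ℝ} (hX : X.IsSymm) {c : ℝ}
    (hc : ∀ v : ι → ℝ, v ⬝ᵥ v = 1 → c ≤ v ⬝ᵥ X *ᵥ v)
    {v : ι → ℝ} (hv : v ⬝ᵥ v = 1) (hvc : v ⬝ᵥ X *ᵥ v = c) : X *ᵥ v = c • v := by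
  have hquad (w : ι → ℝ) : w ⬝ᵥ (X - c • 1) *ᵥ w = w ⬝ᵥ X *ᵥ w - c * (w ⬝ᵥ w) := by
    simp [sub_mulVec, smul_mulVec, dotProduct_sub]
  have hpsd : (X - c • (1 : Matrix ι ι ℝ)).PosSemidef := by
    refine posSemidef_of_isSymm (hX.sub (isSymm_one.smul c)) fun w => ?_
    rw [hquad]
    exact sub_nonneg.mpr (mul_dotProduct_self_le_of_forall_unit_le hc w)
  have hzero := (hpsd.dotProduct_mulVec_zero_iff v).mp (by simp [hquad, hv, hvc])
  rwa [sub_mulVec, smul_mulVec, one_mulVec, sub_eq_zero] at hzero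

theorem hasDerivWithinAt_dotProduct_mulVec {ι : Type*} [Fintype ι] {X : ℝ → Matrix ι ι ℝ}
    {X' : Matrix ι ι ℝ} {I : Set ℝ} {t : ℝ}
    (h : ∀ k l, HasDerivWithinAt (fun s => X s k l) (X' k l) I t) (v : ι → ℝ) :
    HasDerivWithinAt (fun s => v ⬝ᵥ X s *ᵥ v) (v ⬝ᵥ X' *ᵥ v) I t := by
  simp only [dotProduct, mulVec]
  exact HasDerivWithinAt.fun_sum fun k _ =>
    (HasDerivWithinAt.fun_sum fun l _ => (h k l).mul_const (v l)).const_mul (v k)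

theorem ContinuousOn.dotProduct_mulVec_prod {ι : Type*} [Fintype ι] {X : ℝ → Matrix ι ι ℝ}
    {I : Set ℝ} (h : ContinuousOn X I) (K : Set (ι → ℝ)) :
    ContinuousOn (fun p : ℝ × (ι → ℝ) => p.2 ⬝ᵥ X p.1 *ᵥ p.2) (I ×ˢ K) := by
  rw [continuousOn_iff_continuous_domRestrict]
  have hX : Continuous fun p : I ×ˢ K => X p.1.1 :=
    (h.comp continuousOn_fst fun _ hp => hp.1).domRestrict
  have hv : Continuous fun p : I ×ˢ K => p.1.2 := continuous_snd.comp continuous_subtype_val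
  exact hv.dotProduct (hX.matrix_mulVec hv)

/-- Along a Lyapunov equation, the derivative of `X` on an eigenvector. -/
theorem dotProduct_mulVec_of_lyapunov {ι : Type*} [Fintype ι] {X X' C R : Matrix ι ι ℝ}
    (hX : X.IsSymm) (h : X' + X * C + Cᵀ * X + R = 0) {c : ℝ} {v : ι → ℝ}
    (hv : X *ᵥ v = c • v) :
    v ⬝ᵥ X' *ᵥ v = -(2 * c * (v ⬝ᵥ C *ᵥ v)) - v ⬝ᵥ R *ᵥ v := by
  have hX' : X' = -(X * C) - Cᵀ * X - R := by
    rw [← sub_eq_zero, ← h]; abel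
  have h1 : v ⬝ᵥ (X * C) *ᵥ v = c * (v ⬝ᵥ C *ᵥ v) := by
    rw [← mulVec_mulVec, dotProduct_mulVec, ← mulVec_transpose, hX.eq, hv, smul_dotProduct,
      smul_eq_mul]
  have h2 : v ⬝ᵥ (Cᵀ * X) *ᵥ v = c * (v ⬝ᵥ C *ᵥ v) := by
    rw [← mulVec_mulVec, dotProduct_mulVec, vecMul_transpose, hv, dotProduct_smul, smul_eq_mul,
      dotProduct_comm]
  rw [hX', sub_mulVec, sub_mulVec, neg_mulVec, dotProduct_sub, dotProduct_sub, dotProduct_neg,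
    h1, h2]
  ring

/-- Solutions of a differential Lyapunov equation with positive semidefinite forcing and terminal
value are positive semidefinite. -/
theorem posSemidef_of_lyapunov {ι : Type*} [Fintype ι] [DecidableEq ι] {a b : ℝ}
    {X X' C R : ℝ → Matrix ι ι ℝ} (hsymm : ∀ t ∈ Icc a b, (X t).IsSymm)
    (hderiv : ∀ t ∈ Icc a b, ∀ k l,
      HasDerivWithinAt (fun s => X s k l) (X' t k l) (Icc a b) t)
    (hC : ContinuousOn C (Icc a b))
    (heq : ∀ t ∈ Icc a b, X' t + X t * C t + (C t)ᵀ * X t + R t = 0)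
    (hR : ∀ t ∈ Icc a b, (R t).PosSemidef) (hb : (X b).PosSemidef) :
    ∀ t ∈ Icc a b, (X t).PosSemidef := by
  set K : Set (ι → ℝ) := {v | v ⬝ᵥ v = 1}
  have hcomp : IsCompact (Icc a b ×ˢ K) :=
    isCompact_Icc.prod isCompact_setOf_dotProduct_self_eq_one
  have hXcont : ContinuousOn X (Icc a b) :=
    continuousOn_pi.mpr fun k => continuousOn_pi.mpr fun l t ht =>
      (hderiv t ht k l).continuousWithinAt
  obtain ⟨B, hB⟩ := (hcomp.image_of_continuousOn (hC.dotProduct_mulVec_prod K)).bddAbove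
  have hB' (t) (ht : t ∈ Icc a b) (v : ι → ℝ) (hv : v ⬝ᵥ v = 1) : v ⬝ᵥ C t *ᵥ v ≤ B :=
    hB ⟨(t, v), ⟨ht, hv⟩, rfl⟩
  set L : ℝ := 2 * B + 1 with hL
  -- the exponential weight dominates the drift at a negative minimum
  set g : ℝ × (ι → ℝ) → ℝ := fun p => Real.exp (L * p.1) * (p.2 ⬝ᵥ X p.1 *ᵥ p.2)
  have hgcont : ContinuousOn g (Icc a b ×ˢ K) :=
    (by fun_prop : Continuous fun p : ℝ × (ι → ℝ) => Real.exp (L * p.1)).continuousOn.mul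
      (hXcont.dotProduct_mulVec_prod K)
  have hunit : ∀ t ∈ Icc a b, ∀ v : ι → ℝ, v ⬝ᵥ v = 1 → 0 ≤ v ⬝ᵥ X t *ᵥ v := by
    by_contra! hneg
    obtain ⟨s, hs, w, hw, hsw⟩ := hneg
    obtain ⟨⟨τ, v⟩, ⟨hτ, hv⟩, hmin⟩ := hcomp.exists_isMinOn ⟨(s, w), hs, hw⟩ hgcont
    replace hτ : τ ∈ Icc a b := hτ
    have hmin' (t) (ht : t ∈ Icc a b) (u : ι → ℝ) (hu : u ⬝ᵥ u = 1) : g (τ, v) ≤ g (t, u) :=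
      hmin (a := (t, u)) ⟨ht, hu⟩
    set c := v ⬝ᵥ X τ *ᵥ v with hc
    have hcneg : c < 0 := by
      have h : g (τ, v) < 0 :=
        (hmin' s hs w hw).trans_lt (mul_neg_of_pos_of_neg (Real.exp_pos _) hsw)
      exact neg_of_mul_neg_right h (Real.exp_pos _).le
    have hτb : τ < b := by
      refine hτ.2.lt_of_ne fun h => hcneg.not_ge ?_
      rw [hc, h]
      simpa using hb.dotProduct_mulVec_nonneg v
    have heig : X τ *ᵥ v = c • v :=
      mulVec_eq_smul_of_forall_unit_le (hsymm τ hτ)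
        (fun u hu => le_of_mul_le_mul_left (hmin' τ hτ u hu) (Real.exp_pos _)) hv rfl
    have hexp : HasDerivWithinAt (fun t => Real.exp (L * t)) (Real.exp (L * τ) * L)
        (Icc a b) τ := by
      simpa using (((hasDerivAt_id τ).const_mul L).exp).hasDerivWithinAt
    have hd := derivWithin_nonneg_of_isMinOn_Icc hτ hτb
      (isMinOn_iff.mpr fun t ht => hmin' t ht v hv)
      (hexp.mul (hasDerivWithinAt_dotProduct_mulVec (hderiv τ hτ) v))
    rw [dotProduct_mulVec_of_lyapunov (hsymm τ hτ) (heq τ hτ) heig, ← hc, mul_assoc, ← mul_add]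
      at hd
    have hd' := nonneg_of_mul_nonneg_right hd (Real.exp_pos _)
    have hRv : 0 ≤ v ⬝ᵥ R τ *ᵥ v := by simpa using (hR τ hτ).dotProduct_mulVec_nonneg v
    nlinarith [hB' τ hτ v hv]
  intro t ht
  refine posSemidef_of_isSymm (hsymm t ht) fun w => ?_
  simpa using mul_dotProduct_self_le_of_forall_unit_le (hunit t ht) w

/-- Solutions of a differential Lyapunov equation with positive definite forcing and terminal
value are positive definite. -/
theorem posDef_of_lyapunov {ι : Type*} [Fintype ι] [DecidableEq ι] {a b : ℝ}
    {X X' C R : ℝ → Matrix ι ι ℝ} (hsymm : ∀ t ∈ Icc a b, (X t).IsSymm)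
    (hderiv : ∀ t ∈ Icc a b, ∀ k l,
      HasDerivWithinAt (fun s => X s k l) (X' t k l) (Icc a b) t)
    (hC : ContinuousOn C (Icc a b))
    (heq : ∀ t ∈ Icc a b, X' t + X t * C t + (C t)ᵀ * X t + R t = 0)
    (hR : ∀ t ∈ Icc a b, (R t).PosDef) (hb : (X b).PosDef) :
    ∀ t ∈ Icc a b, (X t).PosDef := by
  have hpsd := posSemidef_of_lyapunov hsymm hderiv hC heq (fun t ht => (hR t ht).posSemidef)
    hb.posSemidef
  have hnonneg (t) (ht : t ∈ Icc a b) (v : ι → ℝ) : 0 ≤ v ⬝ᵥ X t *ᵥ v := by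
    simpa using (hpsd t ht).dotProduct_mulVec_nonneg v
  intro t ht
  rcases ht.2.eq_or_lt with rfl | htb
  · exact hb
  refine .of_dotProduct_mulVec_pos (hpsd t ht).isHermitian fun v hv => ?_
  rw [star_trivial]
  refine (hnonneg t ht v).lt_of_ne' fun hzero => ?_
  have hker : X t *ᵥ v = (0 : ℝ) • v := by
    rw [zero_smul]
    exact ((hpsd t ht).dotProduct_mulVec_zero_iff v).mp (by simpa using hzero)
  have hd := derivWithin_nonneg_of_isMinOn_Icc ht htb
    (isMinOn_iff.mpr fun s hs => hzero.trans_le (hnonneg s hs v))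
    (hasDerivWithinAt_dotProduct_mulVec (hderiv t ht) v)
  rw [dotProduct_mulVec_of_lyapunov (hsymm t ht) (heq t ht) hker] at hd
  have hRv : 0 < v ⬝ᵥ R t *ᵥ v := by simpa using (hR t ht).dotProduct_mulVec_pos hv
  linarith

/-- The coupled Riccati equation rewritten as a Lyapunov equation. -/
theorem riccati_eq_lyapunov {n M : ℕ} {A S S' Q G : Matrix (Fin n) (Fin n) ℝ}
    {H T : Fin M → Matrix (Fin n) (Fin n) ℝ} (hS : S.IsSymm) (hT : ∀ j, (T j).IsSymm)
    (hH : ∀ j, (H j).IsSymm) (hG : G.IsSymm)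
    (h : S' + S * A + Aᵀ * S + Q + S * G * S
      - ∑ j, (S * H j * T j + T j * H j * S) = 0) :
    S' + S * (A - ∑ j, H j * T j + (1 / 2 : ℝ) • (G * S))
      + (A - ∑ j, H j * T j + (1 / 2 : ℝ) • (G * S))ᵀ * S + Q = 0 := by
  rw [← h]
  have hterm (j) : (H j * T j)ᵀ = T j * H j := by rw [transpose_mul, (hH j).eq, (hT j).eq]
  have hhalf : S * G * S = (1 / 2 : ℝ) • (S * G * S) + (1 / 2 : ℝ) • (S * G * S) := by
    rw [← add_smul]; norm_num
  simp only [transpose_add, transpose_sub, transpose_sum, transpose_smul, hterm, transpose_mul,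
    hG.eq, hS.eq, mul_add, add_mul, mul_sub, sub_mul, Finset.mul_sum, Finset.sum_mul,
    Matrix.mul_smul, Matrix.smul_mul, Finset.sum_add_distrib, ← mul_assoc]
  conv_rhs => rw [hhalf]
  abel

/-- **Theorem 1 (definiteness of AAO solutions).**
Players are indexed by `Fin M`, with index `0` playing the role of player 1
(the opposing player).  If `{S i}` is a solution set of the AAO coupled Riccati
equations on `I = [t_f − δ, t_f] ⊆ [t_0, t_f]` (with `0 < δ ≤ t_f − t_0`), then for
every `t ∈ I` the matrix `S 0 t` is negative definite and the matrices `S i t`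
(`i ≠ 0`) are positive semidefinite. -/
theorem aao_definiteness {n M : ℕ} [NeZero M] (hn : 1 ≤ n) (hM : 2 ≤ M)
    {t0 tf : ℝ} (ht : t0 < tf)
    (A : ℝ → Matrix (Fin n) (Fin n) ℝ)
    (H Q : Fin M → ℝ → Matrix (Fin n) (Fin n) ℝ)
    (Sf : Fin M → Matrix (Fin n) (Fin n) ℝ)
    (hAcont : ∀ k l, ContinuousOn (fun t => A t k l) (Icc t0 tf))
    (hHcont : ∀ i k l, ContinuousOn (fun t => H i t k l) (Icc t0 tf))
    (hQcont : ∀ i k l, ContinuousOn (fun t => Q i t k l) (Icc t0 tf))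
    (hHpsd : ∀ i, ∀ t ∈ Icc t0 tf, (H i t).PosSemidef)
    (hQ1 : ∀ t ∈ Icc t0 tf, (-(Q 0 t)).PosDef)
    (hQi : ∀ i : Fin M, i ≠ 0 → ∀ t ∈ Icc t0 tf, (Q i t).PosSemidef)
    (hSf1 : (-(Sf 0)).PosDef)
    (hSfi : ∀ i : Fin M, i ≠ 0 → (Sf i).PosSemidef)
    {δ : ℝ} (hδ0 : 0 < δ) (hδ : δ ≤ tf - t0)
    (S S' : Fin M → ℝ → Matrix (Fin n) (Fin n) ℝ)
    (hSsym : ∀ i, ∀ t ∈ Icc (tf - δ) tf, (S i t).IsSymm)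
    (hSderiv : ∀ i, ∀ t ∈ Icc (tf - δ) tf, ∀ k l,
      HasDerivWithinAt (fun s => S i s k l) (S' i t k l) (Icc (tf - δ) tf) t)
    (hS'cont : ∀ i k l, ContinuousOn (fun t => S' i t k l) (Icc (tf - δ) tf))
    (hRic : ∀ i, ∀ t ∈ Icc (tf - δ) tf,
      S' i t + S i t * A t + (A t)ᵀ * S i t + Q i t + S i t * H i t * S i t
        - ∑ j, (S i t * H j t * S j t + S j t * H j t * S i t) = 0)
    (hterm : ∀ i, S i tf = Sf i) :
    ∀ t ∈ Icc (tf - δ) tf,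
      (-(S 0 t)).PosDef ∧ ∀ i : Fin M, i ≠ 0 → (S i t).PosSemidef := by
  have hsub : Icc (tf - δ) tf ⊆ Icc t0 tf := Icc_subset_Icc_left (by linarith)
  have htf : tf ∈ Icc (tf - δ) tf := ⟨by linarith, le_rfl⟩
  have hHsymm (i) (t) (ht : t ∈ Icc (tf - δ) tf) : (H i t).IsSymm := by
    simpa [IsHermitian, IsSymm] using (hHpsd i t (hsub ht)).isHermitian
  have hSc (i) : ContinuousOn (S i) (Icc (tf - δ) tf) :=
    continuousOn_pi.mpr fun k => continuousOn_pi.mpr fun l t ht =>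
      (hSderiv i t ht k l).continuousWithinAt
  have hAc : ContinuousOn A (Icc (tf - δ) tf) :=
    continuousOn_pi.mpr fun k => continuousOn_pi.mpr fun l => (hAcont k l).mono hsub
  have hHc (i) : ContinuousOn (H i) (Icc (tf - δ) tf) :=
    continuousOn_pi.mpr fun k => continuousOn_pi.mpr fun l => (hHcont i k l).mono hsub
  set C : Fin M → ℝ → Matrix (Fin n) (Fin n) ℝ := fun i t =>
    A t - ∑ j, H j t * S j t + (1 / 2 : ℝ) • (H i t * S i t)
  have hHSc (i) : ContinuousOn (fun t => H i t * S i t) (Icc (tf - δ) tf) :=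
    (hHc i).mul (hSc i)
  have hC (i) : ContinuousOn (C i) (Icc (tf - δ) tf) :=
    (hAc.sub (continuousOn_finsetSum _ fun j _ => hHSc j)).add ((hHSc i).const_smul (1 / 2 : ℝ))
  have hLyap (i) (t) (ht : t ∈ Icc (tf - δ) tf) :
      S' i t + S i t * C i t + (C i t)ᵀ * S i t + Q i t = 0 :=
    riccati_eq_lyapunov (hSsym i t ht) (fun j => hSsym j t ht) (fun j => hHsymm j t ht)
      (hHsymm i t ht) (hRic i t ht)
  refine fun t ht => ⟨?_, fun i hi => ?_⟩
  · refine posDef_of_lyapunov (X := fun t => -S 0 t) (X' := fun t => -S' 0 t)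
      (R := fun t => -Q 0 t) (fun s hs => (hSsym 0 s hs).neg)
      (fun s hs k l => (hSderiv 0 s hs k l).neg) (hC 0) (fun s hs => ?_)
      (fun s hs => hQ1 s (hsub hs)) (by simpa [hterm] using hSf1) t ht
    rw [← neg_eq_zero, ← hLyap 0 s hs]
    simp only [neg_mul, mul_neg]
    abel
  · exact posSemidef_of_lyapunov (hSsym i) (hSderiv i) (hC i) (hLyap i)
      (fun s hs => hQi i hi s (hsub hs)) (by simpa [hterm] using hSfi i hi) t ht
end

section
/- (Positive semidefiniteness is preserved backward in time by Lyapunov-type matrix ODEs) Let C, W : I → ℝ^{n×n} be continuous matrix functions on an interval I = [a, t_f], with W(t) symmetric positive semidefinite for every t ∈ I. If S : I → ℝ^{n×n} is continuously differentiable, symmetric-valued, satisfies Ṡ(t) + S(t)C(t) + C(t)ᵀS(t) + W(t) = 0 for all t ∈ I, and S(t_f) is positive semidefinite, then S(t) is positive semidefinite for every t ∈ I. -/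
open Matrix Set

lemma isCompact_dotProduct_self_eq_one (n : ℕ) :
    IsCompact {v : Fin n → ℝ | v ⬝ᵥ v = 1} := by
  refine Metric.isCompact_of_isClosed_isBounded ?_ ?_
  · exact isClosed_eq (by simp only [dotProduct]; fun_prop) continuous_const
  · refine isBounded_iff_forall_norm_le.mpr ⟨1, fun v hv => ?_⟩
    refine (pi_norm_le_iff_of_nonneg zero_le_one).mpr fun i => ?_
    have h : v i * v i ≤ v ⬝ᵥ v :=
      Finset.single_le_sum (f := fun j => v j * v j) (fun j _ => mul_self_nonneg (v j))
        (Finset.mem_univ i)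
    rw [mem_ofPred_eq.mp hv] at h
    exact abs_le_one_iff_mul_self_le_one.mpr h

lemma continuousOn_quadraticForm {n : ℕ} {s : Set ℝ} {M : ℝ → Matrix (Fin n) (Fin n) ℝ}
    (hM : ∀ k l, ContinuousOn (fun t => M t k l) s) (K : Set (Fin n → ℝ)) :
    ContinuousOn (fun p : ℝ × (Fin n → ℝ) => p.2 ⬝ᵥ (M p.1 *ᵥ p.2)) (s ×ˢ K) := by
  simp only [dotProduct, mulVec]
  refine continuousOn_finsetSum _ fun i _ => ContinuousOn.mul (by fun_prop) ?_
  refine continuousOn_finsetSum _ fun j _ => ContinuousOn.mul ?_ (by fun_prop)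
  exact (hM i j).comp continuousOn_fst fun p hp => hp.1

lemma hasDerivWithinAt_quadraticForm {n : ℕ} {s : Set ℝ} {t : ℝ}
    {M : ℝ → Matrix (Fin n) (Fin n) ℝ} {M' : Matrix (Fin n) (Fin n) ℝ}
    (hM : ∀ k l, HasDerivWithinAt (fun r => M r k l) (M' k l) s t) (v : Fin n → ℝ) :
    HasDerivWithinAt (fun r => v ⬝ᵥ (M r *ᵥ v)) (v ⬝ᵥ (M' *ᵥ v)) s t := by
  simp only [dotProduct, mulVec]
  exact HasDerivWithinAt.fun_sum fun i _ => HasDerivWithinAt.const_mul _ <|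
    HasDerivWithinAt.fun_sum fun j _ => (hM i j).mul_const _

/-- A lower bound for a quadratic form on the unit sphere extends to all vectors by homogeneity. -/
lemma mul_dotProduct_self_le_quadraticForm {n : ℕ} {A : Matrix (Fin n) (Fin n) ℝ} {m : ℝ}
    (hA : ∀ w : Fin n → ℝ, w ⬝ᵥ w = 1 → m ≤ w ⬝ᵥ (A *ᵥ w)) (w : Fin n → ℝ) :
    m * (w ⬝ᵥ w) ≤ w ⬝ᵥ (A *ᵥ w) := by
  rcases eq_or_ne w 0 with rfl | hw
  · simp
  have hpos : 0 < w ⬝ᵥ w := by simpa using dotProduct_star_self_pos_iff.mpr hw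
  set c := (√(w ⬝ᵥ w))⁻¹
  have hc : c * c * (w ⬝ᵥ w) = 1 := by
    rw [← mul_inv, Real.mul_self_sqrt hpos.le, inv_mul_cancel₀ hpos.ne']
  have h := hA (c • w) (by
    rw [dotProduct_smul, smul_dotProduct, smul_eq_mul, smul_eq_mul, ← mul_assoc, hc])
  rw [mulVec_smul, dotProduct_smul, smul_dotProduct, smul_eq_mul, smul_eq_mul, ← mul_assoc] at h
  calc m * (w ⬝ᵥ w) ≤ c * c * (w ⬝ᵥ (A *ᵥ w)) * (w ⬝ᵥ w) :=
        mul_le_mul_of_nonneg_right h hpos.le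
    _ = c * c * (w ⬝ᵥ w) * (w ⬝ᵥ (A *ᵥ w)) := by ring
    _ = w ⬝ᵥ (A *ᵥ w) := by rw [hc, one_mul]

/-- A unit vector minimizing the quadratic form of a symmetric matrix over the unit sphere is an
eigenvector for the minimum. -/
lemma mulVec_eq_smul_of_minimizer {n : ℕ} {A : Matrix (Fin n) (Fin n) ℝ} (hA : A.IsSymm)
    {v : Fin n → ℝ} (hv : v ⬝ᵥ v = 1)
    (hmin : ∀ w : Fin n → ℝ, w ⬝ᵥ w = 1 → v ⬝ᵥ (A *ᵥ v) ≤ w ⬝ᵥ (A *ᵥ w)) :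
    A *ᵥ v = (v ⬝ᵥ (A *ᵥ v)) • v := by
  set m := v ⬝ᵥ (A *ᵥ v) with hm
  have hB (w : Fin n → ℝ) : (A - m • (1 : Matrix (Fin n) (Fin n) ℝ)) *ᵥ w = A *ᵥ w - m • w := by
    rw [sub_mulVec, smul_mulVec, one_mulVec]
  have hpsd : (A - m • (1 : Matrix (Fin n) (Fin n) ℝ)).PosSemidef := by
    refine PosSemidef.of_dotProduct_mulVec_nonneg ?_ fun w => ?_
    · rw [IsHermitian, conjTranspose_eq_transpose_of_trivial, transpose_sub, hA.eq,
        transpose_smul, transpose_one]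
    · rw [star_trivial, hB, dotProduct_sub, dotProduct_smul, smul_eq_mul, sub_nonneg]
      exact mul_dotProduct_self_le_quadraticForm hmin w
  have h0 := (hpsd.dotProduct_mulVec_zero_iff v).mp (by
    rw [star_trivial, hB, dotProduct_sub, dotProduct_smul, hv, ← hm, smul_eq_mul, mul_one,
      sub_self])
  rwa [hB, sub_eq_zero] at h0

lemma nonneg_of_isMinOn_Icc_of_hasDerivWithinAt {f : ℝ → ℝ} {f' a b t : ℝ}
    (ht : t ∈ Icc a b) (htb : t < b) (hmin : IsMinOn f (Icc a b) t)
    (hf : HasDerivWithinAt f f' (Icc a b) t) : 0 ≤ f' := by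
  have h := hmin.localize.hasFDerivWithinAt_nonneg hf.hasFDerivWithinAt
    (sub_mem_posTangentConeAt_of_segment_subset
      ((convex_Icc a b).segment_subset ht (right_mem_Icc.mpr (ht.1.trans ht.2))))
  have h' : 0 ≤ (b - t) * f' := by simpa using h
  exact (mul_nonneg_iff_of_pos_left (sub_pos.mpr htb)).mp h'


/-- **Positive semidefiniteness is preserved backward in time by Lyapunov-type
matrix ODEs.**  If `W(t) ⪰ 0` on `[a, t_f]`, `S` is continuously differentiable,
symmetric-valued, solves `Ṡ + SC + CᵀS + W = 0`, and `S(t_f) ⪰ 0`, then `S(t) ⪰ 0`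
for every `t ∈ [a, t_f]`. -/
theorem lyapunov_backward_posSemidef {n : ℕ} (hn : 1 ≤ n)
    {a tf : ℝ} (hatf : a < tf)
    (C W : ℝ → Matrix (Fin n) (Fin n) ℝ)
    (hCcont : ∀ k l, ContinuousOn (fun t => C t k l) (Icc a tf))
    (hWcont : ∀ k l, ContinuousOn (fun t => W t k l) (Icc a tf))
    (hWpsd : ∀ t ∈ Icc a tf, (W t).PosSemidef)
    (S S' : ℝ → Matrix (Fin n) (Fin n) ℝ)
    (hSsym : ∀ t ∈ Icc a tf, (S t).IsSymm)
    (hSderiv : ∀ t ∈ Icc a tf, ∀ k l,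
      HasDerivWithinAt (fun s => S s k l) (S' t k l) (Icc a tf) t)
    (hS'cont : ∀ k l, ContinuousOn (fun t => S' t k l) (Icc a tf))
    (hode : ∀ t ∈ Icc a tf, S' t + S t * C t + (C t)ᵀ * S t + W t = 0)
    (hfinal : (S tf).PosSemidef) :
    ∀ t ∈ Icc a tf, (S t).PosSemidef := by

  set Q : Set (Fin n → ℝ) := {v | v ⬝ᵥ v = 1}
  have hcpt : IsCompact (Icc a tf ×ˢ Q) := isCompact_Icc.prod (isCompact_dotProduct_self_eq_one n)
  obtain ⟨K, hK⟩ := hcpt.exists_bound_of_continuousOn (continuousOn_quadraticForm hCcont Q)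
  have hScont (k l) : ContinuousOn (fun t => S t k l) (Icc a tf) :=
    fun t ht => (hSderiv t ht k l).continuousWithinAt
  set L : ℝ := 2 * K + 1
  let g : ℝ × (Fin n → ℝ) → ℝ := fun p => Real.exp (L * p.1) * (p.2 ⬝ᵥ (S p.1 *ᵥ p.2))
  have hg : ContinuousOn g (Icc a tf ×ˢ Q) :=
    ContinuousOn.mul (by fun_prop) (continuousOn_quadraticForm hScont Q)
  -- It suffices that the minimum of `g` over time and the unit sphere is nonnegative.
  suffices hnonneg : ∀ p ∈ Icc a tf ×ˢ Q, 0 ≤ g p by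
    intro t ht
    refine PosSemidef.of_dotProduct_mulVec_nonneg ?_ fun w => ?_
    · rw [IsHermitian, conjTranspose_eq_transpose_of_trivial, (hSsym t ht).eq]
    rw [star_trivial]
    have h := mul_dotProduct_self_le_quadraticForm (A := S t) (m := 0)
      (fun u hu => (mul_nonneg_iff_of_pos_left (Real.exp_pos _)).mp (hnonneg (t, u) ⟨ht, hu⟩)) w
    rwa [zero_mul] at h
  by_contra! hneg
  obtain ⟨p, hp, hgp⟩ := hneg
  obtain ⟨⟨t, v⟩, ⟨ht, hv⟩, hmin⟩ := hcpt.exists_isMinOn ⟨p, hp⟩ hg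
  have hgt : g (t, v) < 0 := (hmin hp).trans_lt hgp
  have hexp : 0 < Real.exp (L * t) := Real.exp_pos _
  have hμ : v ⬝ᵥ (S t *ᵥ v) < 0 := (pos_iff_neg_of_mul_neg hgt).mp hexp
  have htf : t < tf := by
    refine ht.2.lt_of_ne fun h => hμ.not_ge ?_
    replace h : t = tf := h
    rw [h, ← star_trivial v]
    exact hfinal.dotProduct_mulVec_nonneg _
  have heig : S t *ᵥ v = (v ⬝ᵥ (S t *ᵥ v)) • v :=
    mulVec_eq_smul_of_minimizer (hSsym t ht) hv fun w hw =>
      le_of_mul_le_mul_left (hmin (show (t, w) ∈ Icc a tf ×ˢ Q from ⟨ht, hw⟩)) hexp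
  set μ := v ⬝ᵥ (S t *ᵥ v) with hμdef
  have hderiv : HasDerivWithinAt (fun s => g (s, v))
      (Real.exp (L * t) * (L * 1) * μ + Real.exp (L * t) * (v ⬝ᵥ (S' t *ᵥ v))) (Icc a tf) t :=
    ((hasDerivWithinAt_id t _).const_mul L).exp.mul
      (hasDerivWithinAt_quadraticForm (hSderiv t ht) v)
  have hnn := nonneg_of_isMinOn_Icc_of_hasDerivWithinAt ht htf
    (isMinOn_iff.mpr fun s hs => hmin (show (s, v) ∈ Icc a tf ×ˢ Q from ⟨hs, hv⟩)) hderiv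
  have hSC : v ⬝ᵥ ((S t * C t) *ᵥ v) = μ * (v ⬝ᵥ (C t *ᵥ v)) := by
    rw [← mulVec_mulVec, dotProduct_mulVec, ← mulVec_transpose, (hSsym t ht).eq, heig,
      smul_dotProduct, smul_eq_mul]
  have hCS : v ⬝ᵥ (((C t)ᵀ * S t) *ᵥ v) = μ * (v ⬝ᵥ (C t *ᵥ v)) := by
    rw [← mulVec_mulVec, heig, mulVec_smul, dotProduct_smul, smul_eq_mul, dotProduct_mulVec,
      vecMul_transpose, dotProduct_comm]
  have hode' : v ⬝ᵥ (S' t *ᵥ v) + 2 * μ * (v ⬝ᵥ (C t *ᵥ v)) + v ⬝ᵥ (W t *ᵥ v) = 0 := by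
    have h := congrArg (fun M => v ⬝ᵥ (M *ᵥ v)) (hode t ht)
    simp only [add_mulVec, dotProduct_add, hSC, hCS, zero_mulVec, dotProduct_zero] at h
    linarith
  have hW : 0 ≤ v ⬝ᵥ (W t *ᵥ v) := by
    simpa using (hWpsd t ht).dotProduct_mulVec_nonneg v
  have hC : v ⬝ᵥ (C t *ᵥ v) ≤ K := (le_abs_self _).trans (hK (t, v) ⟨ht, hv⟩)
  have hsum : 0 ≤ L * μ + v ⬝ᵥ (S' t *ᵥ v) := by
    refine (mul_nonneg_iff_of_pos_left hexp).mp ?_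
    linarith
  have hKC := mul_nonneg_of_nonpos_of_nonpos hμ.le (sub_nonpos.mpr hC)
  simp only [L] at hsum
  linarith
end

section
/- (Lemma 1) Let A : [t_0, t_f] → ℝ^{n×n} be continuous and bounded, let I = [t_f − δ, t_f] ⊆ [t_0, t_f] with 0 < δ ≤ t_f − t_0, and let Y : I → ℝ^{n×n} be a continuously differentiable symmetric matrix function with Y(t_f) = 0 satisfying the Loewner-order differential inequality Ẏ(t) ⪯ −Y(t)A(t) − A(t)ᵀY(t) for all t ∈ I. Then Y(t) ⪰ 0 for all t ∈ I. -/
open Matrix Set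

open Filter Topology in
/-- A real function that is nonnegative at points to the right of a nonpositive value has
nonnegative right derivative there. -/
theorem HasDerivWithinAt.nonneg_of_nonneg_right {f : ℝ → ℝ} {f' s b : ℝ} (hsb : s < b)
    (hf : HasDerivWithinAt f f' (Ioc s b) s) (hs : f s ≤ 0) (hpos : ∀ t ∈ Ioc s b, 0 ≤ f t) :
    0 ≤ f' := by
  rw [hasDerivWithinAt_iff_tendsto_slope' (by simp), nhdsWithin_Ioc_eq_nhdsGT hsb] at hf
  refine ge_of_tendsto hf ?_
  filter_upwards [Ioc_mem_nhdsGT hsb] with t ht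
  rw [slope_def_field]
  exact div_nonneg (by linarith [hpos t ht]) (by linarith [ht.1])

section QuadraticForm

variable {n : Type*} [Fintype n]

theorem ContinuousOn.dotProduct_mulVec_self {M : ℝ → Matrix n n ℝ} {s : Set ℝ}
    (hM : ∀ k l, ContinuousOn (fun t => M t k l) s) (u : Set (n → ℝ)) :
    ContinuousOn (fun p : ℝ × (n → ℝ) => p.2 ⬝ᵥ M p.1 *ᵥ p.2) (s ×ˢ u) := by
  simp only [dotProduct, mulVec]
  refine continuousOn_finsetSum _ fun i _ => ContinuousOn.mul (by fun_prop) ?_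
  refine continuousOn_finsetSum _ fun j _ => ContinuousOn.mul ?_ (by fun_prop)
  exact (hM i j).comp continuousOn_fst fun p hp => hp.1

theorem HasDerivWithinAt.dotProduct_mulVec_self {M : ℝ → Matrix n n ℝ} {M' : Matrix n n ℝ}
    {s : Set ℝ} {t : ℝ} (hM : ∀ k l, HasDerivWithinAt (fun r => M r k l) (M' k l) s t)
    (v : n → ℝ) :
    HasDerivWithinAt (fun r => v ⬝ᵥ M r *ᵥ v) (v ⬝ᵥ M' *ᵥ v) s t := by
  simp only [dotProduct, mulVec]
  exact HasDerivWithinAt.fun_sum fun i _ =>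
    (HasDerivWithinAt.fun_sum fun j _ => (hM i j).mul_const (v j)).const_mul (v i)

theorem Matrix.dotProduct_mulVec_smul_self (M : Matrix n n ℝ) (c : ℝ) (v : n → ℝ) :
    (c • v) ⬝ᵥ M *ᵥ (c • v) = c ^ 2 * (v ⬝ᵥ M *ᵥ v) := by
  simp only [mulVec_smul, dotProduct_smul, smul_dotProduct, smul_eq_mul]
  ring

/-- If a symmetric matrix function is positive definite at the right endpoint of an interval, and
its derivative is negative on its kernel, then it is positive definite on the whole interval. -/
theorem Matrix.posDef_of_deriv_neg_on_ker {a b : ℝ} {Z Z' : ℝ → Matrix n n ℝ}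
    (hsymm : ∀ t ∈ Icc a b, (Z t).IsSymm)
    (hderiv : ∀ t ∈ Icc a b, ∀ k l,
      HasDerivWithinAt (fun s => Z s k l) (Z' t k l) (Icc a b) t)
    (hb : (Z b).PosDef)
    (hker : ∀ t ∈ Icc a b, ∀ v ≠ 0, Z t *ᵥ v = 0 → v ⬝ᵥ Z' t *ᵥ v < 0) :
    ∀ t ∈ Icc a b, (Z t).PosDef := by
  have hcont := ContinuousOn.dotProduct_mulVec_self
    (fun k l t ht => (hderiv t ht k l).continuousWithinAt) (Metric.sphere (0 : n → ℝ) 1)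
  have hcompact : IsCompact (Icc a b ×ˢ Metric.sphere (0 : n → ℝ) 1) :=
    isCompact_Icc.prod (isCompact_sphere _ _)
  set S := (Icc a b ×ˢ Metric.sphere (0 : n → ℝ) 1) ∩
    {p | p.2 ⬝ᵥ Z p.1 *ᵥ p.2 ≤ 0}
  have hScompact : IsCompact S :=
    hcompact.of_isClosed_subset
      (hcont.preimage_isClosed_of_isClosed hcompact.isClosed isClosed_Iic) inter_subset_left
  have hpos : ∀ t ∈ Icc a b, (∀ p ∈ S, p.1 < t) → ∀ v ≠ 0, 0 < v ⬝ᵥ Z t *ᵥ v := by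
    intro t ht hlt v hv
    by_contra! hle
    refine (hlt (t, ‖v‖⁻¹ • v) ⟨⟨ht, ?_⟩, ?_⟩).ne rfl
    · simp [norm_smul, hv]
    · simp only [mem_ofPred_eq, dotProduct_mulVec_smul_self]
      exact mul_nonpos_of_nonneg_of_nonpos (sq_nonneg _) hle
  obtain hempty | hne := S.eq_empty_or_nonempty
  · intro t ht
    refine .of_dotProduct_mulVec_pos (hsymm t ht) fun v hv => ?_
    exact hpos t ht (by simp [hempty]) v hv
  obtain ⟨⟨s, v⟩, hsv, hmax⟩ := hScompact.exists_isMaxOn hne continuousOn_fst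
  have hs : s ∈ Icc a b := hsv.1.1
  have hv : v ≠ 0 := ne_zero_of_mem_unit_sphere ⟨v, hsv.1.2⟩
  have hsv0 : v ⬝ᵥ Z s *ᵥ v ≤ 0 := hsv.2
  have hsb : s < b := by
    refine hs.2.lt_of_ne ?_
    rintro rfl
    exact (hb.dotProduct_mulVec_pos hv).not_ge hsv0
  have hsub : Ioc s b ⊆ Icc a b := fun t ht => ⟨hs.1.trans ht.1.le, ht.2⟩
  have hright : ∀ t ∈ Ioc s b, ∀ w ≠ 0, 0 < w ⬝ᵥ Z t *ᵥ w := fun t ht =>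
    hpos t (hsub ht) fun p hp => lt_of_le_of_lt (hmax hp) ht.1
  have hderivs (w : n → ℝ) :=
    (HasDerivWithinAt.dotProduct_mulVec_self (hderiv s hs) w).mono hsub
  have hpsd : (Z s).PosSemidef := by
    refine .of_dotProduct_mulVec_nonneg (hsymm s hs) fun w => ?_
    have htend := (hderivs w).continuousWithinAt.tendsto
    rw [nhdsWithin_Ioc_eq_nhdsGT hsb] at htend
    refine ge_of_tendsto htend ?_
    filter_upwards [Ioc_mem_nhdsGT hsb] with t ht
    obtain rfl | hw := eq_or_ne w 0
    · simp
    · exact (hright t ht w hw).le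
  have hkerv : Z s *ᵥ v = 0 :=
    (hpsd.dotProduct_mulVec_zero_iff v).1 (hsv0.antisymm (hpsd.dotProduct_mulVec_nonneg v))
  exact absurd (hker s hs v hv hkerv)
    ((hderivs v).nonneg_of_nonneg_right hsb hsv0 fun t ht => (hright t ht v hv).le).not_gt

/-- The quadratic form of a continuous matrix function is bounded on compact intervals. -/
theorem Matrix.exists_dotProduct_mulVec_le {a b : ℝ} {A : ℝ → Matrix n n ℝ}
    (hA : ∀ k l, ContinuousOn (fun t => A t k l) (Icc a b)) :
    ∃ C : ℝ, ∀ t ∈ Icc a b, ∀ v : n → ℝ, v ⬝ᵥ A t *ᵥ v ≤ C * (v ⬝ᵥ v) := by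
  have hcompact : IsCompact (Icc a b ×ˢ Metric.sphere (0 : n → ℝ) 1) :=
    isCompact_Icc.prod (isCompact_sphere _ _)
  have hcont : ContinuousOn
      (fun p : ℝ × (n → ℝ) => (p.2 ⬝ᵥ A p.1 *ᵥ p.2) / (p.2 ⬝ᵥ p.2))
      (Icc a b ×ˢ Metric.sphere (0 : n → ℝ) 1) := by
    refine (ContinuousOn.dotProduct_mulVec_self hA _).div
      (continuous_snd.dotProduct continuous_snd).continuousOn fun p hp => ?_
    exact dotProduct_self_eq_zero.not.2 (ne_zero_of_mem_unit_sphere ⟨p.2, hp.2⟩)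
  obtain ⟨C, hC⟩ := hcompact.bddAbove_image hcont
  refine ⟨C, fun t ht v => ?_⟩
  obtain rfl | hv := eq_or_ne v 0
  · simp
  have hvv : 0 < v ⬝ᵥ v := by simpa using dotProduct_star_self_pos_iff.2 hv
  have hle := hC (mem_image_of_mem _
    (show (t, ‖v‖⁻¹ • v) ∈ _ from ⟨ht, by simp [norm_smul, hv]⟩))
  have hv0 : ‖v‖⁻¹ ^ 2 ≠ 0 := by simpa using hv
  simp only [dotProduct_mulVec_smul_self] at hle
  rw [smul_dotProduct, dotProduct_smul, smul_smul, smul_eq_mul, ← sq,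
    mul_div_mul_left _ _ hv0] at hle
  exact (div_le_iff₀ hvv).1 hle

end QuadraticForm

/-- **Lemma 1.**  If `Y` is a continuously differentiable symmetric matrix
function on `I = [t_f − δ, t_f] ⊆ [t_0, t_f]` with `Y(t_f) = 0` satisfying the
Loewner-order differential inequality `Ẏ(t) ⪯ −Y(t)A(t) − A(t)ᵀY(t)` on `I`,
then `Y(t) ⪰ 0` for all `t ∈ I`. -/
theorem lemma1_backward_nonneg {n : ℕ} (hn : 1 ≤ n)
    {t0 tf : ℝ} (ht : t0 < tf)
    (A : ℝ → Matrix (Fin n) (Fin n) ℝ)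
    (hAcont : ∀ k l, ContinuousOn (fun t => A t k l) (Icc t0 tf))
    {δ : ℝ} (hδ0 : 0 < δ) (hδ : δ ≤ tf - t0)
    (Y Y' : ℝ → Matrix (Fin n) (Fin n) ℝ)
    (hYsym : ∀ t ∈ Icc (tf - δ) tf, (Y t).IsSymm)
    (hYderiv : ∀ t ∈ Icc (tf - δ) tf, ∀ k l,
      HasDerivWithinAt (fun s => Y s k l) (Y' t k l) (Icc (tf - δ) tf) t)
    (hY'cont : ∀ k l, ContinuousOn (fun t => Y' t k l) (Icc (tf - δ) tf))
    (hineq : ∀ t ∈ Icc (tf - δ) tf,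
      (-(Y t * A t) - (A t)ᵀ * Y t - Y' t).PosSemidef)
    (hfinal : Y tf = 0) :
    ∀ t ∈ Icc (tf - δ) tf, (Y t).PosSemidef := by
  obtain ⟨C, hC⟩ := exists_dotProduct_mulVec_le hAcont
  have hsub : Icc (tf - δ) tf ⊆ Icc t0 tf := Icc_subset_Icc_left (by linarith)
  set K : ℝ := 2 * C + 1 with hK
  have hperturbed : ∀ ε > 0, ∀ t ∈ Icc (tf - δ) tf,
      (Y t + (ε * Real.exp (K * (tf - t))) • (1 : Matrix (Fin n) (Fin n) ℝ)).PosDef := by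
    intro ε hε
    refine posDef_of_deriv_neg_on_ker
      (Z' := fun t => Y' t + (ε * (Real.exp (K * (tf - t)) * (K * -1))) •
        (1 : Matrix (Fin n) (Fin n) ℝ)) ?_ ?_ ?_ ?_
    · exact fun t ht => (hYsym t ht).add (isSymm_one.smul _)
    · intro t ht k l
      simp only [Matrix.add_apply, Matrix.smul_apply, smul_eq_mul]
      refine (hYderiv t ht k l).add (HasDerivAt.hasDerivWithinAt ?_)
      exact ((((hasDerivAt_id t).const_sub tf).const_mul K).exp.const_mul ε).mul_const _
    · simpa [hfinal] using PosDef.one.smul hε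
    · intro t ht v hv hker
      have hvv : 0 < v ⬝ᵥ v := by simpa using dotProduct_star_self_pos_iff.2 hv
      have hE : 0 < ε * Real.exp (K * (tf - t)) := by positivity
      set E := ε * Real.exp (K * (tf - t)) with hEdef
      have hYv : Y t *ᵥ v = -(E • v) := by
        rw [add_mulVec, smul_mulVec, one_mulVec] at hker
        exact eq_neg_of_add_eq_zero_left hker
      have hYA : v ⬝ᵥ (Y t * A t) *ᵥ v = -(E * (v ⬝ᵥ A t *ᵥ v)) := by
        rw [← mulVec_mulVec, dotProduct_mulVec, ← mulVec_transpose, (hYsym t ht).eq, hYv,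
          neg_dotProduct, smul_dotProduct, smul_eq_mul]
      have hAY : v ⬝ᵥ ((A t)ᵀ * Y t) *ᵥ v = -(E * (v ⬝ᵥ A t *ᵥ v)) := by
        rw [← mulVec_mulVec, hYv, dotProduct_mulVec, vecMul_transpose, dotProduct_neg,
          dotProduct_smul, smul_eq_mul, dotProduct_comm]
      have hY' := (hineq t ht).dotProduct_mulVec_nonneg v
      rw [star_trivial, sub_mulVec, sub_mulVec, neg_mulVec, dotProduct_sub, dotProduct_sub,
        dotProduct_neg, hYA, hAY] at hY'
      rw [add_mulVec, smul_mulVec, one_mulVec, dotProduct_add, dotProduct_smul, smul_eq_mul,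
        show ε * (Real.exp (K * (tf - t)) * (K * -1)) = -(E * K) by rw [hEdef]; ring]
      nlinarith [mul_le_mul_of_nonneg_left (hC t (hsub ht) v) hE.le, mul_pos hE hvv]
  intro t ht
  refine .of_dotProduct_mulVec_nonneg (hYsym t ht) fun v => ?_
  rw [star_trivial]
  have htend : Filter.Tendsto
      (fun ε : ℝ => v ⬝ᵥ Y t *ᵥ v + ε * Real.exp (K * (tf - t)) * (v ⬝ᵥ v))
      (nhdsWithin 0 (Ioi 0)) (nhds (v ⬝ᵥ Y t *ᵥ v)) := by
    refine Filter.Tendsto.mono_left ?_ nhdsWithin_le_nhds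
    exact Continuous.tendsto' (by fun_prop) _ _ (by simp)
  refine ge_of_tendsto htend ?_
  filter_upwards [self_mem_nhdsWithin] with ε hε
  simpa [add_mulVec, smul_mulVec] using
    (hperturbed ε hε t ht).posSemidef.dotProduct_mulVec_nonneg v
end

section
/- (Contraction property of the Picard operator) Let Q : [t_0, t_f] → ℝ^{n×n} be a continuous bounded symmetric matrix function, let L_Q be the associated comparison solution, l̄_q = sup_{s ∈ [t_0,t_f]} ‖L_Q(s)‖_F, h̄ = max_{1≤i≤M} sup_t ‖H_i(t)‖_F, K̄_c = 2 sup_t ‖A(t)‖_F + 2M h̄ l̄_q, and δ̂ = 1/(2M K̄_c), and assume δ̂ ≤ t_f − t_0 and set I = [t_f − δ̂, t_f]. Define f_i(t, S_1, …, S_M) = S_i A(t) + A(t)ᵀ S_i + Q_i(t) − S_i H_i(t) S_i − Σ_{j≠i} (S_i H_j(t) S_j + S_j H_j(t) S_i). For continuous functions S = (S_1, …, S_M) : I → (symmetric n×n matrices)^M with ‖S_i(t)‖_F ≤ l̄_q for all i and t, define 𝒯(S)(t) = (S_{1f} + ∫_t^{t_f} f_1(τ, S(τ)) dτ, …, S_{Mf}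 + ∫_t^{t_f} f_M(τ, S(τ)) dτ). Then for any two such functions S and S*, sup_{t ∈ I} Σ_{i=1}^M ‖𝒯(S)(t)_i − 𝒯(S*)(t)_i‖_F ≤ (1/2) · sup_{t ∈ I} Σ_{i=1}^M ‖S_i(t) − S_i*(t)‖_F. -/
open Matrix Set

/-- The Frobenius norm of a real square matrix. -/
noncomputable def frobNorm {n : ℕ} (X : Matrix (Fin n) (Fin n) ℝ) : ℝ :=
  Real.sqrt (Matrix.trace (X * Xᵀ))

/-- The Riccati vector field `f_i(t, S_1, …, S_M)` of the AAO game. -/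
def riccatiField {n M : ℕ} (A : ℝ → Matrix (Fin n) (Fin n) ℝ)
    (H Q : Fin M → ℝ → Matrix (Fin n) (Fin n) ℝ)
    (i : Fin M) (t : ℝ) (S : Fin M → Matrix (Fin n) (Fin n) ℝ) :
    Matrix (Fin n) (Fin n) ℝ :=
  S i * A t + (A t)ᵀ * S i + Q i t - S i * H i t * S i
    - ∑ j ∈ Finset.univ.erase i, (S i * H j t * S j + S j * H j t * S i)

/-- The Picard operator `𝒯`, computed entrywise:
`𝒯(S)_i(t) = S_{if} + ∫_t^{t_f} f_i(τ, S(τ)) dτ`. -/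
noncomputable def picardOp {n M : ℕ} (A : ℝ → Matrix (Fin n) (Fin n) ℝ)
    (H Q : Fin M → ℝ → Matrix (Fin n) (Fin n) ℝ)
    (Sf : Fin M → Matrix (Fin n) (Fin n) ℝ) (tfin : ℝ)
    (S : Fin M → ℝ → Matrix (Fin n) (Fin n) ℝ) (i : Fin M) (t : ℝ) :
    Matrix (Fin n) (Fin n) ℝ :=
  Matrix.of fun k l =>
    Sf i k l + ∫ τ in t..tfin, (riccatiField A H Q i τ fun j => S j τ) k l

attribute [local instance] Matrix.frobeniusNormedAddCommGroup Matrix.frobeniusNormedSpace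
  Matrix.frobeniusNormedRing

theorem frobNorm_eq_norm {n : ℕ} (X : Matrix (Fin n) (Fin n) ℝ) : frobNorm X = ‖X‖ := by
  rw [frobNorm, Matrix.frobenius_norm_def, Real.sqrt_eq_rpow]
  congr 1
  simp [Matrix.trace, Matrix.mul_apply, sq]

theorem continuousOn_matrix_of_entries {n : ℕ} {X : ℝ → Matrix (Fin n) (Fin n) ℝ} {s : Set ℝ}
    (h : ∀ k l, ContinuousOn (fun t => X t k l) s) : ContinuousOn X s :=
  continuousOn_pi.2 fun k => continuousOn_pi.2 fun l => h k l

theorem norm_le_sSup_frobNorm {n : ℕ} {X : ℝ → Matrix (Fin n) (Fin n) ℝ} {a b t : ℝ}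
    (hX : ContinuousOn X (Icc a b)) (ht : t ∈ Icc a b) :
    ‖X t‖ ≤ sSup ((fun s => frobNorm (X s)) '' Icc a b) := by
  simp only [frobNorm_eq_norm]
  exact le_csSup (isCompact_Icc.image_of_continuousOn hX.norm).bddAbove (mem_image_of_mem _ ht)

/-- Perturbation bound for a trilinear product with fixed middle factor. -/
theorem norm_mul_mul_sub_le {R : Type*} [NormedRing R] {X X' H Y Y' : R} {h l : ℝ}
    (hH : ‖H‖ ≤ h) (hY : ‖Y‖ ≤ l) (hX' : ‖X'‖ ≤ l) :
    ‖X * H * Y - X' * H * Y'‖ ≤ h * l * (‖X - X'‖ + ‖Y - Y'‖) := by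
  have hh : 0 ≤ h := (norm_nonneg _).trans hH
  have hl : 0 ≤ l := (norm_nonneg _).trans hY
  have e : X * H * Y - X' * H * Y' = (X - X') * H * Y + X' * H * (Y - Y') := by noncomm_ring
  calc ‖X * H * Y - X' * H * Y'‖
      ≤ ‖X - X'‖ * ‖H‖ * ‖Y‖ + ‖X'‖ * ‖H‖ * ‖Y - Y'‖ := by
        rw [e]
        refine (norm_add_le _ _).trans (add_le_add ?_ ?_) <;>
          exact (norm_mul_le _ _).trans (by gcongr; exact norm_mul_le _ _)
    _ ≤ ‖X - X'‖ * h * l + l * h * ‖Y - Y'‖ := by gcongr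
    _ = h * l * (‖X - X'‖ + ‖Y - Y'‖) := by ring

theorem norm_riccatiField_sub_le {n M : ℕ} {A : ℝ → Matrix (Fin n) (Fin n) ℝ}
    {H Q : Fin M → ℝ → Matrix (Fin n) (Fin n) ℝ} {t a h l : ℝ}
    {S S' : Fin M → Matrix (Fin n) (Fin n) ℝ} (hA : ‖A t‖ ≤ a) (hH : ∀ i, ‖H i t‖ ≤ h)
    (hS : ∀ i, ‖S i‖ ≤ l) (hS' : ∀ i, ‖S' i‖ ≤ l) (i : Fin M) :
    ‖riccatiField A H Q i t S - riccatiField A H Q i t S'‖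
      ≤ (2 * a + 2 * M * h * l) * ∑ j, ‖S j - S' j‖ := by
  have ha : 0 ≤ a := (norm_nonneg _).trans hA
  have hh : 0 ≤ h := (norm_nonneg _).trans (hH i)
  have hl : 0 ≤ l := (norm_nonneg _).trans (hS i)
  set d : Fin M → ℝ := fun j => ‖S j - S' j‖ with hd
  have hd0 : ∀ j, 0 ≤ d j := fun j => norm_nonneg _
  have hM : (1 : ℝ) ≤ M := by exact_mod_cast i.pos
  have e : riccatiField A H Q i t S - riccatiField A H Q i t S'
      = (S i - S' i) * A t + (A t)ᵀ * (S i - S' i)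
        - (S i * H i t * S i - S' i * H i t * S' i)
        - ∑ j ∈ Finset.univ.erase i, ((S i * H j t * S j - S' i * H j t * S' j)
          + (S j * H j t * S i - S' j * H j t * S' i)) := by
    have : ∀ j, (S i * H j t * S j - S' i * H j t * S' j)
          + (S j * H j t * S i - S' j * H j t * S' i)
        = (S i * H j t * S j + S j * H j t * S i)
          - (S' i * H j t * S' j + S' j * H j t * S' i) := fun j => by abel
    simp only [riccatiField, this, Finset.sum_sub_distrib]
    noncomm_ring
  have h1 : ‖(S i - S' i) * A t‖ ≤ a * d i :=
    (norm_mul_le _ _).trans (by rw [mul_comm]; gcongr)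
  have h2 : ‖(A t)ᵀ * (S i - S' i)‖ ≤ a * d i :=
    (norm_mul_le _ _).trans (by rw [Matrix.frobenius_norm_transpose]; gcongr)
  have h3 := norm_mul_mul_sub_le (X := S i) (Y' := S' i) (hH i) (hS i) (hS' i)
  have h4 : ‖∑ j ∈ Finset.univ.erase i, ((S i * H j t * S j - S' i * H j t * S' j)
          + (S j * H j t * S i - S' j * H j t * S' i))‖
      ≤ ∑ j ∈ Finset.univ.erase i, 2 * h * l * (d i + d j) := by
    refine norm_sum_le_of_le _ fun j _ => (norm_add_le _ _).trans ?_
    have p := norm_mul_mul_sub_le (X := S i) (Y' := S' j) (hH j) (hS j) (hS' i)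
    have q := norm_mul_mul_sub_le (X := S j) (Y' := S' i) (hH j) (hS i) (hS' j)
    simp only [hd]
    linarith
  have hsum : ∑ j ∈ Finset.univ.erase i, 2 * h * l * (d i + d j)
      = 2 * h * l * ((M - 2) * d i + ∑ j, d j) := by
    rw [← Finset.mul_sum, Finset.sum_add_distrib, Finset.sum_erase_eq_sub (Finset.mem_univ i),
      Finset.sum_erase_eq_sub (Finset.mem_univ i), Finset.sum_const, nsmul_eq_mul,
      Finset.card_univ, Fintype.card_fin]
    ring
  have hle : d i ≤ ∑ j, d j := Finset.single_le_sum (fun j _ => hd0 j) (Finset.mem_univ i)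
  rw [hsum] at h4
  rw [e]
  calc _ ≤ a * d i + a * d i + h * l * (d i + d i) + 2 * h * l * ((M - 2) * d i + ∑ j, d j) :=
        (norm_sub_le _ _).trans (add_le_add ((norm_sub_le _ _).trans
          (add_le_add ((norm_add_le _ _).trans (add_le_add h1 h2)) h3)) h4)
    _ = 2 * a * d i + 2 * h * l * ((M - 1) * d i + ∑ j, d j) := by ring
    _ ≤ 2 * a * ∑ j, d j + 2 * h * l * ((M - 1) * ∑ j, d j + ∑ j, d j) := by
        have : (0 : ℝ) ≤ M - 1 := by linarith
        gcongr
    _ = (2 * a + 2 * M * h * l) * ∑ j, d j := by ring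

theorem ContinuousOn.riccatiField {n M : ℕ} {A : ℝ → Matrix (Fin n) (Fin n) ℝ}
    {H Q S : Fin M → ℝ → Matrix (Fin n) (Fin n) ℝ} {s : Set ℝ} (hA : ContinuousOn A s)
    (hH : ∀ i, ContinuousOn (H i) s) (hQ : ∀ i, ContinuousOn (Q i) s)
    (hS : ∀ i, ContinuousOn (S i) s) (i : Fin M) :
    ContinuousOn (fun t => riccatiField A H Q i t fun j => S j t) s := by
  have hAT : ContinuousOn (fun t => (A t)ᵀ) s :=
    (continuous_id.matrix_transpose).comp_continuousOn hA
  unfold _root_.riccatiField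
  exact ((((hS i).mul hA).add (hAT.mul (hS i))).add (hQ i)).sub
    (((hS i).mul (hH i)).mul (hS i)) |>.sub <| continuousOn_finsetSum _ fun j _ =>
      (((hS i).mul (hH j)).mul (hS j)).add (((hS j).mul (hH j)).mul (hS i))

/-- The vector integral of a bounded continuous curve, characterised by its linear functionals. -/
theorem exists_norm_le_forall_apply_eq_intervalIntegral {E : Type*} [NormedAddCommGroup E]
    [NormedSpace ℝ E] [FiniteDimensional ℝ E] {F : ℝ → E} {a b C : ℝ}
    (hF : ContinuousOn F (uIcc a b)) (hC : ∀ τ ∈ uIcc a b, ‖F τ‖ ≤ C) :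
    ∃ v : E, ‖v‖ ≤ C * |b - a| ∧ ∀ φ : E →ₗ[ℝ] ℝ, φ v = ∫ τ in a..b, φ (F τ) := by
  have : CompleteSpace E := FiniteDimensional.complete ℝ E
  exact ⟨∫ τ in a..b, F τ,
    intervalIntegral.norm_integral_le_of_norm_le_const fun τ hτ => hC τ (uIoc_subset_uIcc hτ),
    fun φ => ((LinearMap.toContinuousLinearMap φ).intervalIntegral_comp_comm
      hF.intervalIntegrable).symm⟩

theorem norm_picardOp_sub_le {n M : ℕ} {A : ℝ → Matrix (Fin n) (Fin n) ℝ}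
    {H Q S S' : Fin M → ℝ → Matrix (Fin n) (Fin n) ℝ} {Sf : Fin M → Matrix (Fin n) (Fin n) ℝ}
    {t b C : ℝ} {i : Fin M}
    (hF : ContinuousOn (fun τ => riccatiField A H Q i τ fun j => S j τ) (uIcc t b))
    (hF' : ContinuousOn (fun τ => riccatiField A H Q i τ fun j => S' j τ) (uIcc t b))
    (hC : ∀ τ ∈ uIcc t b, ‖(riccatiField A H Q i τ fun j => S j τ)
      - riccatiField A H Q i τ fun j => S' j τ‖ ≤ C) :
    ‖picardOp A H Q Sf b S i t - picardOp A H Q Sf b S' i t‖ ≤ C * |b - t| := by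
  obtain ⟨v, hv, hφ⟩ := exists_norm_le_forall_apply_eq_intervalIntegral (hF.sub hF') hC
  suffices picardOp A H Q Sf b S i t - picardOp A H Q Sf b S' i t = v by rwa [this]
  ext k l
  have hentry : ∀ {X : ℝ → Matrix (Fin n) (Fin n) ℝ}, ContinuousOn X (uIcc t b) →
      IntervalIntegrable (fun τ => X τ k l) MeasureTheory.volume t b := fun hX =>
    (continuousOn_pi.1 (continuousOn_pi.1 hX k) l).intervalIntegrable
  rw [show v k l = _ from hφ (Matrix.entryLinearMap ℝ ℝ k l)]
  simp only [picardOp, Matrix.sub_apply, Matrix.of_apply, Matrix.entryLinearMap_apply,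
    add_sub_add_left_eq_sub]
  exact (intervalIntegral.integral_sub (hentry hF) (hentry hF')).symm

/-- **Contraction property of the Picard operator.**  With
`l̄_q = sup ‖L_Q‖_F`, `h̄ = max_i sup ‖H_i‖_F`, `K̄_c = 2 sup ‖A‖_F + 2M h̄ l̄_q`
and `δ̂ = 1/(2M K̄_c)`, the operator `𝒯` is a `1/2`-contraction on the set of
continuous symmetric-matrix-valued tuples on `I = [t_f − δ̂, t_f]` bounded in
Frobenius norm by `l̄_q`. -/
theorem picard_contraction {n M : ℕ} [NeZero M] (hn : 1 ≤ n) (hM : 2 ≤ M)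
    {t0 tf : ℝ} (ht : t0 < tf)
    (A : ℝ → Matrix (Fin n) (Fin n) ℝ)
    (H Q : Fin M → ℝ → Matrix (Fin n) (Fin n) ℝ)
    (Sf : Fin M → Matrix (Fin n) (Fin n) ℝ)
    (hAcont : ∀ k l, ContinuousOn (fun t => A t k l) (Icc t0 tf))
    (hHcont : ∀ i k l, ContinuousOn (fun t => H i t k l) (Icc t0 tf))
    (hQcont : ∀ i k l, ContinuousOn (fun t => Q i t k l) (Icc t0 tf))
    (hHpsd : ∀ i, ∀ t ∈ Icc t0 tf, (H i t).PosSemidef)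
    (hQ1 : ∀ t ∈ Icc t0 tf, (-(Q 0 t)).PosDef)
    (hQi : ∀ i : Fin M, i ≠ 0 → ∀ t ∈ Icc t0 tf, (Q i t).PosSemidef)
    (hSf1 : (-(Sf 0)).PosDef)
    (hSfi : ∀ i : Fin M, i ≠ 0 → (Sf i).PosSemidef)
    -- the comparison data
    (Qc : ℝ → Matrix (Fin n) (Fin n) ℝ)
    (hQccont : ∀ k l, ContinuousOn (fun t => Qc t k l) (Icc t0 tf))
    (hQcsym : ∀ t ∈ Icc t0 tf, (Qc t).IsSymm)
    (LQ LQ' : ℝ → Matrix (Fin n) (Fin n) ℝ)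
    (hLQderiv : ∀ t ∈ Icc t0 tf, ∀ k l,
      HasDerivWithinAt (fun s => LQ s k l) (LQ' t k l) (Icc t0 tf) t)
    (hLQeq : ∀ t ∈ Icc t0 tf,
      LQ' t = -(LQ t * A t) - (A t)ᵀ * LQ t
        - (Qc t - Q 0 t + ∑ i ∈ Finset.univ.erase 0, Q i t))
    (hLQf : LQ tf = -(Sf 0) + ∑ i ∈ Finset.univ.erase 0, Sf i)
    -- the constants
    (lq : ℝ) (hlq : lq = sSup ((fun s => frobNorm (LQ s)) '' Icc t0 tf))
    (hbar : ℝ)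
    (hhbar : hbar = ⨆ i : Fin M, sSup ((fun s => frobNorm (H i s)) '' Icc t0 tf))
    (Kbar : ℝ)
    (hKbar : Kbar = 2 * sSup ((fun s => frobNorm (A s)) '' Icc t0 tf)
      + 2 * (M : ℝ) * hbar * lq)
    (dhat : ℝ) (hdhat : dhat = 1 / (2 * (M : ℝ) * Kbar))
    (hdle : dhat ≤ tf - t0) :
    ∀ S Sstar : Fin M → ℝ → Matrix (Fin n) (Fin n) ℝ,
      (∀ i k l, ContinuousOn (fun t => S i t k l) (Icc (tf - dhat) tf)) →
      (∀ i, ∀ t ∈ Icc (tf - dhat) tf, (S i t).IsSymm) →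
      (∀ i, ∀ t ∈ Icc (tf - dhat) tf, frobNorm (S i t) ≤ lq) →
      (∀ i k l, ContinuousOn (fun t => Sstar i t k l) (Icc (tf - dhat) tf)) →
      (∀ i, ∀ t ∈ Icc (tf - dhat) tf, (Sstar i t).IsSymm) →
      (∀ i, ∀ t ∈ Icc (tf - dhat) tf, frobNorm (Sstar i t) ≤ lq) →
      sSup ((fun t => ∑ i, frobNorm
          (picardOp A H Q Sf tf S i t - picardOp A H Q Sf tf Sstar i t))
        '' Icc (tf - dhat) tf)
      ≤ (1 / 2) * sSup ((fun t => ∑ i, frobNorm (S i t - Sstar i t))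
        '' Icc (tf - dhat) tf) := by
  intro S S' hSc _ hSb hSc' _ hSb'
  simp only [frobNorm_eq_norm] at hSb hSb' ⊢
  have hM0 : (0 : ℝ) < M := by exact_mod_cast Nat.pos_of_neZero M
  have hA := continuousOn_matrix_of_entries hAcont
  have hH := fun i => continuousOn_matrix_of_entries (hHcont i)
  have hQ := fun i => continuousOn_matrix_of_entries (hQcont i)
  have hS := fun i => continuousOn_matrix_of_entries (hSc i)
  have hS' := fun i => continuousOn_matrix_of_entries (hSc' i)
  set a := sSup ((fun s => frobNorm (A s)) '' Icc t0 tf)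
  have hAb : ∀ t ∈ Icc t0 tf, ‖A t‖ ≤ a := fun t h => norm_le_sSup_frobNorm hA h
  have hHb : ∀ i, ∀ t ∈ Icc t0 tf, ‖H i t‖ ≤ hbar := fun i t h => by
    rw [hhbar]
    exact (norm_le_sSup_frobNorm (hH i) h).trans
      (le_ciSup (f := fun i => sSup ((fun s => frobNorm (H i s)) '' Icc t0 tf))
        (Set.finite_range _).bddAbove i)
  have htf : tf ∈ Icc t0 tf := right_mem_Icc.2 ht.le
  have ha : 0 ≤ a := (norm_nonneg _).trans (hAb tf htf)
  have hh : 0 ≤ hbar := (norm_nonneg _).trans (hHb 0 tf htf)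
  have hl : 0 ≤ lq := by
    rw [hlq]
    exact Real.sSup_nonneg (by rintro _ ⟨s, _, rfl⟩; exact Real.sqrt_nonneg _)
  have hK : 0 ≤ Kbar := by rw [hKbar]; positivity
  have hd : 0 ≤ dhat := by rw [hdhat]; positivity
  have hdK : dhat * (M * Kbar) ≤ 1 / 2 := by
    rcases hK.eq_or_lt with h0 | h0
    · rw [← h0]; norm_num
    · rw [hdhat]; apply le_of_eq; field_simp
  have hsub : Icc (tf - dhat) tf ⊆ Icc t0 tf := Icc_subset_Icc_left (by linarith)
  have hne : (Icc (tf - dhat) tf).Nonempty := nonempty_Icc.2 (by linarith)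
  set D := sSup ((fun t => ∑ i, ‖S i t - S' i t‖) '' Icc (tf - dhat) tf)
  have hD : ∀ t ∈ Icc (tf - dhat) tf, ∑ i, ‖S i t - S' i t‖ ≤ D := fun t h =>
    le_csSup (isCompact_Icc.image_of_continuousOn
      (continuousOn_finsetSum _ fun i _ => ((hS i).sub (hS' i)).norm)).bddAbove
      (mem_image_of_mem _ h)
  have hD0 : 0 ≤ D := (Finset.sum_nonneg fun i _ => norm_nonneg _).trans
    (hD tf (right_mem_Icc.2 (by linarith)))
  refine csSup_le (hne.image _) ?_
  rintro _ ⟨t, htI, rfl⟩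
  have hcI : uIcc t tf ⊆ Icc (tf - dhat) tf := by
    rw [uIcc_of_le htI.2]; exact Icc_subset_Icc_left htI.1
  have hcont : ∀ {X : Fin M → ℝ → Matrix (Fin n) (Fin n) ℝ},
      (∀ i, ContinuousOn (X i) (Icc (tf - dhat) tf)) → ∀ i,
      ContinuousOn (fun τ => riccatiField A H Q i τ fun j => X j τ) (uIcc t tf) := fun hX i =>
    (ContinuousOn.riccatiField (hA.mono hsub) (fun i => (hH i).mono hsub)
      (fun i => (hQ i).mono hsub) hX i).mono hcI
  have hi : ∀ i, ‖picardOp A H Q Sf tf S i t - picardOp A H Q Sf tf S' i t‖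
      ≤ Kbar * D * dhat := fun i => by
    refine (norm_picardOp_sub_le (C := Kbar * D) (hcont hS i) (hcont hS' i)
      fun τ hτ => ?_).trans ?_
    · have hτI := hcI hτ
      refine (norm_riccatiField_sub_le (hAb τ (hsub hτI)) (fun i => hHb i τ (hsub hτI))
        (fun i => hSb i τ hτI) (fun i => hSb' i τ hτI) i).trans ?_
      rw [← hKbar]
      exact mul_le_mul_of_nonneg_left (hD τ hτI) hK
    · rw [abs_of_nonneg (by linarith [htI.2])]
      exact mul_le_mul_of_nonneg_left (by linarith [htI.1]) (by positivity)
  calc ∑ i, ‖picardOp A H Q Sf tf S i t - picardOp A H Q Sf tf S' i t‖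
      ≤ ∑ _i : Fin M, Kbar * D * dhat := Finset.sum_le_sum fun i _ => hi i
    _ = dhat * (M * Kbar) * D := by simp; ring
    _ ≤ 1 / 2 * D := mul_le_mul_of_nonneg_right hdK hD0
end

section
/- (Equation (18): the sum of the Riccati solutions satisfies a Lyapunov-type equation) Let {S_1, …, S_M} be a solution set of the AAO coupled Riccati equations on an interval I = [t_f − δ, t_f] ⊆ [t_0, t_f], and define P(t) = Σ_{i=1}^M S_i(t) and Ā(t) = A(t) − Σ_{j=1}^M H_j(t) S_j(t). Then for all t ∈ I, Ṗ(t) + P(t)Ā(t) + Ā(t)ᵀP(t) + Σ_{i=1}^M Q_i(t) + Σ_{i=1}^M S_i(t) H_i(t) S_i(t) = 0, and P(t_f) = Σ_{i=1}^M S_{if}. -/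
open Matrix Set

/-- **Equation (18).**  For a solution set `{S i}` of the AAO coupled Riccati
equations on `I = [t_f − δ, t_f]`, the sum `P(t) = Σ_i S_i(t)` satisfies the
Lyapunov-type equation
`Ṗ + P Ā + Āᵀ P + Σ_i Q_i + Σ_i S_i H_i S_i = 0`, `P(t_f) = Σ_i S_{if}`,
where `Ā(t) = A(t) − Σ_j H_j(t) S_j(t)`. -/
theorem aao_sum_lyapunov_equation {n M : ℕ} [NeZero M] (hn : 1 ≤ n) (hM : 2 ≤ M)
    {t0 tf : ℝ} (ht : t0 < tf)
    (A : ℝ → Matrix (Fin n) (Fin n) ℝ)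
    (H Q : Fin M → ℝ → Matrix (Fin n) (Fin n) ℝ)
    (Sf : Fin M → Matrix (Fin n) (Fin n) ℝ)
    (hAcont : ∀ k l, ContinuousOn (fun t => A t k l) (Icc t0 tf))
    (hHcont : ∀ i k l, ContinuousOn (fun t => H i t k l) (Icc t0 tf))
    (hQcont : ∀ i k l, ContinuousOn (fun t => Q i t k l) (Icc t0 tf))
    (hHpsd : ∀ i, ∀ t ∈ Icc t0 tf, (H i t).PosSemidef)
    (hQ1 : ∀ t ∈ Icc t0 tf, (-(Q 0 t)).PosDef)
    (hQi : ∀ i : Fin M, i ≠ 0 → ∀ t ∈ Icc t0 tf, (Q i t).PosSemidef)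
    (hSf1 : (-(Sf 0)).PosDef)
    (hSfi : ∀ i : Fin M, i ≠ 0 → (Sf i).PosSemidef)
    {δ : ℝ} (hδ0 : 0 < δ) (hδ : δ ≤ tf - t0)
    (S S' : Fin M → ℝ → Matrix (Fin n) (Fin n) ℝ)
    (hSsym : ∀ i, ∀ t ∈ Icc (tf - δ) tf, (S i t).IsSymm)
    (hSderiv : ∀ i, ∀ t ∈ Icc (tf - δ) tf, ∀ k l,
      HasDerivWithinAt (fun s => S i s k l) (S' i t k l) (Icc (tf - δ) tf) t)
    (hS'cont : ∀ i k l, ContinuousOn (fun t => S' i t k l) (Icc (tf - δ) tf))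
    (hRic : ∀ i, ∀ t ∈ Icc (tf - δ) tf,
      S' i t + S i t * A t + (A t)ᵀ * S i t + Q i t + S i t * H i t * S i t
        - ∑ j, (S i t * H j t * S j t + S j t * H j t * S i t) = 0)
    (hterm : ∀ i, S i tf = Sf i) :
    (∀ t ∈ Icc (tf - δ) tf, ∀ k l,
      HasDerivWithinAt (fun s => (∑ i, S i s) k l) ((∑ i, S' i t) k l)
        (Icc (tf - δ) tf) t) ∧
    (∀ t ∈ Icc (tf - δ) tf,
      (∑ i, S' i t)
        + (∑ i, S i t) * (A t - ∑ j, H j t * S j t)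
        + (A t - ∑ j, H j t * S j t)ᵀ * (∑ i, S i t)
        + (∑ i, Q i t) + (∑ i, S i t * H i t * S i t) = 0) ∧
    (∑ i, S i tf) = ∑ i, Sf i := by
  refine ⟨fun t htI k l => ?_, fun t htI => ?_, Finset.sum_congr rfl fun i _ => hterm i⟩
  · simp only [Matrix.sum_apply]
    exact HasDerivWithinAt.fun_sum fun i _ => hSderiv i t htI k l
  · have hmem : t ∈ Icc t0 tf := ⟨by linarith [htI.1], htI.2⟩
    have hT : (∑ j, H j t * S j t)ᵀ = ∑ j, S j t * H j t := by
      rw [Matrix.transpose_sum]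
      refine Finset.sum_congr rfl fun j _ => ?_
      have hH : (H j t)ᵀ = H j t := by
        simpa only [conjTranspose_eq_transpose_of_trivial] using (hHpsd j t hmem).isHermitian.eq
      rw [transpose_mul, (hSsym j t htI).eq, hH]
    have hsum := Finset.sum_eq_zero fun i (_ : i ∈ Finset.univ) => hRic i t htI
    have hright : ∑ i, ∑ j, S i t * H j t * S j t = (∑ i, S i t) * ∑ j, H j t * S j t := by
      simp only [Finset.sum_mul_sum, Matrix.mul_assoc]
    simp only [Finset.sum_sub_distrib, Finset.sum_add_distrib, hright,
      ← Finset.sum_mul, ← Finset.mul_sum] at hsum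
    rw [transpose_sub, hT, mul_sub, sub_mul, ← hsum]
    abel
end

section
/- (Corollary 1, existence for the diagonal AAO game) Suppose in addition that all the matrices A(t), H_i(t), Q_i(t) (for i = 1, …, M, all t) and S_{if} (for i = 1, …, M) are diagonal. If Q_1(t) + Σ_{i=2}^M Q_i(t) is positive definite for all t, S_{1f} + Σ_{i=2}^M S_{if} is positive definite, and H_1(t) ⪯ H_i(t) for all i = 2, …, M and all t, then there exists a unique solution set {S_1, …, S_M} of the AAO coupled Riccati equations defined on the entire interval [t_0, t_f]. -/
open Matrix Set

/-- `S` (with derivative data `S'`) is a solution set of the AAO coupled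
Riccati equations on the interval `[a, tfin]`, with terminal data `Sf`. -/
def IsAAOSolution {n M : ℕ} (A : ℝ → Matrix (Fin n) (Fin n) ℝ)
    (H Q : Fin M → ℝ → Matrix (Fin n) (Fin n) ℝ)
    (Sf : Fin M → Matrix (Fin n) (Fin n) ℝ) (a tfin : ℝ)
    (S S' : Fin M → ℝ → Matrix (Fin n) (Fin n) ℝ) : Prop :=
  (∀ i, ∀ t ∈ Icc a tfin, (S i t).IsSymm) ∧
  (∀ i, ∀ t ∈ Icc a tfin, ∀ k l,
    HasDerivWithinAt (fun s => S i s k l) (S' i t k l) (Icc a tfin) t) ∧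
  (∀ i k l, ContinuousOn (fun t => S' i t k l) (Icc a tfin)) ∧
  (∀ i, ∀ t ∈ Icc a tfin,
    S' i t + S i t * A t + (A t)ᵀ * S i t + Q i t + S i t * H i t * S i t
      - ∑ j, (S i t * H j t * S j t + S j t * H j t * S i t) = 0) ∧
  (∀ i, S i tfin = Sf i)


open Metric Filter Topology
open scoped NNReal

/-- A differential inequality `w' ≥ c w` with bounded coefficient preserves nonnegativity. -/
lemma nonneg_of_mul_le_deriv {w w' c : ℝ → ℝ} {τ : ℝ}
    (hw : ∀ t ∈ Icc 0 τ, HasDerivWithinAt w (w' t) (Icc 0 τ) t)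
    (hc : ContinuousOn c (Icc 0 τ))
    (hle : ∀ t ∈ Icc 0 τ, c t * w t ≤ w' t) (h0 : 0 ≤ w 0) :
    ∀ t ∈ Icc 0 τ, 0 ≤ w t := by
  obtain ⟨C, hC⟩ := isCompact_Icc.exists_bound_of_continuousOn hc
  intro t ht
  have key : ∀ ε > 0, -w t ≤ ε * Real.exp ((C + 1) * t) := by
    intro ε hε
    refine image_le_of_deriv_right_lt_deriv_boundary (f := fun t => -w t) (f' := fun t => -w' t)
      (a := 0) (b := τ) (B := fun t => ε * Real.exp ((C + 1) * t))
      (B' := fun t => ε * (Real.exp ((C + 1) * t) * (C + 1))) ?_ ?_ ?_ ?_ ?_ ht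
    · exact fun s hs => (hw s hs).continuousWithinAt.neg
    · intro s hs
      exact ((hw s (Ico_subset_Icc_self hs)).mono_of_mem_nhdsWithin
        (Icc_mem_nhdsGE_of_mem hs)).neg
    · simp only [mul_zero, Real.exp_zero, mul_one]
      linarith
    · intro s
      have h1 : HasDerivAt (fun t : ℝ => (C + 1) * t) (C + 1) s := by
        simpa using (hasDerivAt_id s).const_mul (C + 1)
      exact h1.exp.const_mul ε
    · intro s hs heq
      have hs' := Ico_subset_Icc_self hs
      have h1 := hle s hs'
      have h2 := hC s hs'
      rw [Real.norm_eq_abs, abs_le] at h2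
      have hpos : 0 < ε * Real.exp ((C + 1) * s) := by positivity
      have hneg : 0 < -w s := heq ▸ hpos
      have : ε * (Real.exp ((C + 1) * s) * (C + 1)) = (-w s) * (C + 1) := by rw [heq]; ring
      rw [this]
      nlinarith
  by_contra! hlt
  have hE := Real.exp_pos ((C + 1) * t)
  have := key (-w t / (2 * Real.exp ((C + 1) * t))) (by apply div_pos <;> linarith)
  rw [div_mul_eq_mul_div, le_div_iff₀ (by positivity)] at this
  nlinarith

/-- Grönwall bound for `u' ≤ c u + b` with nonnegative constants `c` and `b`. -/
lemma le_of_deriv_le_mul_add {u u' : ℝ → ℝ} {τ b₀ b c : ℝ} (hb : 0 ≤ b) (hc : 0 ≤ c)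
    (hu : ∀ t ∈ Icc 0 τ, HasDerivWithinAt u (u' t) (Icc 0 τ) t)
    (hle : ∀ t ∈ Icc 0 τ, u' t ≤ c * u t + b) (h0 : u 0 ≤ b₀) :
    ∀ t ∈ Icc 0 τ, u t ≤ (b₀ + b * t) * Real.exp (c * t) := by
  intro t ht
  have hd : ∀ t ∈ Icc 0 τ, HasDerivWithinAt
      (fun t => (b₀ + b * t) * Real.exp (c * t) - u t)
      (b * Real.exp (c * t) + (b₀ + b * t) * (Real.exp (c * t) * c) - u' t) (Icc 0 τ) t := by
    intro s hs
    have h1 : HasDerivAt (fun t : ℝ => c * t) c s := by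
      simpa using (hasDerivAt_id s).const_mul c
    have h2 : HasDerivAt (fun t : ℝ => b₀ + b * t) b s := by
      simpa using ((hasDerivAt_id s).const_mul b).const_add b₀
    exact (h2.mul h1.exp).hasDerivWithinAt.sub (hu s hs)
  have := nonneg_of_mul_le_deriv hd (c := fun _ => c) continuousOn_const ?_ ?_ t ht
  · simpa using this
  · intro s hs
    have h1 := hle s hs
    have h2 : 1 ≤ Real.exp (c * s) := Real.one_le_exp (mul_nonneg hc hs.1)
    nlinarith
  · simpa using h0

/-- Coordinatewise truncation to the cube `[-R, R]^ι`. -/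
def truncate {ι : Type*} (R : ℝ) (x : ι → ℝ) : ι → ℝ := fun i => max (-R) (min R (x i))

lemma lipschitzWith_truncate {ι : Type*} [Fintype ι] (R : ℝ) :
    LipschitzWith 1 (truncate (ι := ι) R) := by
  refine LipschitzWith.of_dist_le_mul fun x y => (dist_pi_le_iff (by positivity)).2 fun i => ?_
  exact (((LipschitzWith.eval i).const_min R).const_max (-R)).dist_le_mul x y

lemma truncate_eq_self {ι : Type*} [Fintype ι] {R : ℝ} {x : ι → ℝ} (hx : ‖x‖ ≤ R) :
    truncate R x = x := by
  funext i
  have := abs_le.1 ((norm_le_pi_norm x i).trans hx)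
  simp [truncate, this.1, this.2]

lemma norm_truncate_le {ι : Type*} [Fintype ι] {R : ℝ} (hR : 0 ≤ R) (x : ι → ℝ) :
    ‖truncate R x‖ ≤ R := by
  rw [pi_norm_le_iff_of_nonneg hR]
  intro i
  rw [Real.norm_eq_abs, abs_le]
  exact ⟨le_max_left _ _, max_le (by linarith) (min_le_left _ _)⟩

/-- A `C¹` vector field depending continuously on time is Lipschitz on balls, uniformly on
compact time intervals. -/
lemma exists_lipschitzOnWith_closedBall {P E F : Type*} [NormedAddCommGroup P] [NormedSpace ℝ P]
    [NormedAddCommGroup E] [NormedSpace ℝ E] [ProperSpace E]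
    [NormedAddCommGroup F] [NormedSpace ℝ F]
    {f : P × E → F} (hf : ContDiff ℝ 1 f) {p : ℝ → P} {a b : ℝ}
    (hp : ContinuousOn p (Icc a b)) (R : ℝ) :
    ∃ K : ℝ≥0, ∀ t ∈ Icc a b, LipschitzOnWith K (fun x => f (p t, x)) (closedBall 0 R) := by
  have hcpt : IsCompact ((p '' Icc a b) ×ˢ (closedBall (0 : E) R)) :=
    (isCompact_Icc.image_of_continuousOn hp).prod (isCompact_closedBall _ _)
  obtain ⟨K, hK⟩ := LocallyLipschitzOn.exists_lipschitzOnWith_of_compact hcpt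
    hf.locallyLipschitz.locallyLipschitzOn
  refine ⟨K, fun t ht x hx y hy => ?_⟩
  have := hK (x := (p t, x)) ⟨mem_image_of_mem p ht, hx⟩
    (y := (p t, y)) ⟨mem_image_of_mem p ht, hy⟩
  simpa [Prod.edist_eq] using this

/-- A priori bounds yield global existence for `x' = f(p(t), x)`. -/
lemma exists_solution_of_apriori_bound {ι P : Type*} [Fintype ι] [NormedAddCommGroup P]
    [NormedSpace ℝ P] {f : P × (ι → ℝ) → (ι → ℝ)} (hf : ContDiff ℝ 1 f) {p : ℝ → P} {T : ℝ}
    (hT : 0 ≤ T) (hp : ContinuousOn p (Icc 0 T)) (x₀ : ι → ℝ) (R : ℝ)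
    (hR : ∀ τ ∈ Icc 0 T, ∀ x : ℝ → ι → ℝ, x 0 = x₀ →
      (∀ t ∈ Icc 0 τ, HasDerivWithinAt x (f (p t, x t)) (Icc 0 τ) t) → ‖x τ‖ < R) :
    ∃ x : ℝ → ι → ℝ, x 0 = x₀ ∧
      ∀ t ∈ Icc 0 T, HasDerivWithinAt x (f (p t, x t)) (Icc 0 T) t := by
  have hx₀ : ‖x₀‖ < R := by
    refine hR 0 ⟨le_rfl, hT⟩ (fun _ => x₀) rfl fun t ht => ?_
    exact HasFDerivWithinAt.of_subsingleton (by simp)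
  have hR0 : 0 ≤ R := (norm_nonneg _).trans hx₀.le
  obtain ⟨K, hK⟩ := exists_lipschitzOnWith_closedBall hf hp R
  have hcpt : IsCompact ((p '' Icc 0 T) ×ˢ (closedBall (0 : ι → ℝ) R)) :=
    (isCompact_Icc.image_of_continuousOn hp).prod (isCompact_closedBall _ _)
  obtain ⟨L, hL⟩ := hcpt.exists_bound_of_continuousOn hf.continuous.continuousOn
  have hmem : ∀ x : ι → ℝ, truncate R x ∈ closedBall (0 : ι → ℝ) R := fun x => by
    simpa using norm_truncate_le hR0 x
  have hPL : IsPicardLindelof (fun t x => f (p t, truncate R x))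
      (⟨0, le_rfl, hT⟩ : Icc 0 T) x₀ (L.toNNReal * T.toNNReal) 0 L.toNNReal K := by
    refine ⟨fun t ht => ?_, fun x _ => ?_, fun t ht x _ => ?_, ?_⟩
    · have := (hK t ht).comp ((lipschitzWith_truncate R).lipschitzOnWith (s := univ))
        (fun x _ => hmem x)
      rw [mul_one] at this
      exact this.mono (subset_univ _)
    · exact hf.continuous.comp_continuousOn (hp.prodMk continuousOn_const)
    · exact (hL (p t, truncate R x) ⟨mem_image_of_mem p ht, hmem x⟩).trans
        (Real.le_coe_toNNReal L)
    · simp [hT]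
  obtain ⟨x, hx0, hx⟩ := hPL.exists_eq_forall_mem_Icc_hasDerivWithinAt₀
  simp only at hx0
  have hcont : ContinuousOn x (Icc 0 T) := fun t ht => (hx t ht).continuousWithinAt
  have hlt : ∀ t ∈ Icc 0 T, ‖x t‖ < R := by
    by_contra! hne
    obtain ⟨s, hs, hsR⟩ := hne
    have hclosed : IsClosed (Icc 0 T ∩ (fun t => ‖x t‖) ⁻¹' Ici R) :=
      hcont.norm.preimage_isClosed_of_isClosed isClosed_Icc isClosed_Ici
    obtain ⟨τ, hτ, hmin⟩ := (isCompact_Icc.of_isClosed_subset hclosed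
      inter_subset_left).exists_isLeast ⟨s, hs, hsR⟩
    have hsub : Icc 0 τ ⊆ Icc 0 T := Icc_subset_Icc_right hτ.1.2
    have hlt' : ∀ t ∈ Ico 0 τ, ‖x t‖ < R := by
      intro t ht
      by_contra! hge
      exact absurd (hmin ⟨hsub (Ico_subset_Icc_self ht), hge⟩) (not_le.2 ht.2)
    have hτ0 : 0 < τ := by
      refine hτ.1.1.lt_of_ne fun h => ?_
      have := hτ.2
      rw [← h] at this
      simp only [mem_preimage, mem_Ici, hx0] at this
      linarith
    have hle : ∀ t ∈ Icc 0 τ, ‖x t‖ ≤ R := by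
      rw [← closure_Ico hτ0.ne]
      intro t ht
      refine ContinuousWithinAt.closure_le ht ?_ continuousWithinAt_const
        (fun y hy => (hlt' y hy).le)
      rw [closure_Ico hτ0.ne] at ht
      exact ((hcont t (hsub ht)).mono (Ico_subset_Icc_self.trans hsub)).norm
    refine absurd (hR τ hτ.1 x hx0 fun t ht => ?_) (not_lt.2 hτ.2)
    have := (hx t (hsub ht)).mono hsub
    rwa [truncate_eq_self (hle t ht)] at this
  refine ⟨x, hx0, fun t ht => ?_⟩
  have := hx t ht
  rwa [truncate_eq_self (hlt t ht).le] at this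

/-- The decoupled scalar AAO Riccati vector field in reversed time, as a function of the
coefficients `(a, h, q)` and the state `x`. -/
def diagField {ι : Type*} [Fintype ι] (y : (ℝ × (ι → ℝ) × (ι → ℝ)) × (ι → ℝ)) : ι → ℝ :=
  fun i => 2 * y.1.1 * y.2 i + y.1.2.2 i + y.1.2.1 i * y.2 i ^ 2
    - 2 * y.2 i * ∑ j, y.1.2.1 j * y.2 j

lemma contDiff_diagField {ι : Type*} [Fintype ι] : ContDiff ℝ 1 (diagField (ι := ι)) := by
  unfold diagField
  fun_prop

/-- The reversed-time scalar AAO Riccati system is solvable on the whole interval. -/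
lemma exists_diagField_solution {ι : Type*} [Fintype ι] [DecidableEq ι] (o : ι) {T : ℝ}
    (hT : 0 ≤ T) {a : ℝ → ℝ} {h q : ℝ → ι → ℝ} {x₀ : ι → ℝ}
    (ha : ContinuousOn a (Icc 0 T)) (hh : ContinuousOn h (Icc 0 T))
    (hq : ContinuousOn q (Icc 0 T))
    (hh0 : ∀ t ∈ Icc 0 T, ∀ i, 0 ≤ h t i) (hho : ∀ t ∈ Icc 0 T, ∀ i, h t o ≤ h t i)
    (hqo : ∀ t ∈ Icc 0 T, q t o ≤ 0) (hqi : ∀ t ∈ Icc 0 T, ∀ i, i ≠ o → 0 ≤ q t i)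
    (hqs : ∀ t ∈ Icc 0 T, 0 ≤ ∑ i, q t i)
    (hxo : x₀ o ≤ 0) (hxi : ∀ i, i ≠ o → 0 ≤ x₀ i) (hxs : 0 ≤ ∑ i, x₀ i) :
    ∃ x : ℝ → ι → ℝ, x 0 = x₀ ∧
      ∀ t ∈ Icc 0 T, HasDerivWithinAt x (diagField ((a t, h t, q t), x t)) (Icc 0 T) t := by
  obtain ⟨α, hα⟩ := isCompact_Icc.exists_bound_of_continuousOn ha
  obtain ⟨η, hη⟩ := isCompact_Icc.exists_bound_of_continuousOn hh
  obtain ⟨β', hβ'⟩ := isCompact_Icc.exists_bound_of_continuousOn hq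
  have h0T : (0 : ℝ) ∈ Icc 0 T := ⟨le_rfl, hT⟩
  have hα0 : 0 ≤ α := (norm_nonneg _).trans (hα 0 h0T)
  have hη0 : 0 ≤ η := (norm_nonneg _).trans (hη 0 h0T)
  obtain ⟨β, hβ⟩ : ∃ β, β = max β' ‖x₀‖ := ⟨_, rfl⟩
  have hβ0 : 0 ≤ β := hβ ▸ (norm_nonneg _).trans (le_max_right _ _)
  have hqβ : ∀ t ∈ Icc 0 T, ∀ i, |q t i| ≤ β := fun t ht i =>
    ((norm_le_pi_norm (q t) i).trans (hβ' t ht)).trans (hβ ▸ le_max_left _ _)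
  have hxβ : ∀ i, |x₀ i| ≤ β := fun i =>
    (norm_le_pi_norm x₀ i).trans (hβ ▸ le_max_right _ _)
  have hhη : ∀ t ∈ Icc 0 T, h t o ≤ η := fun t ht =>
    (le_abs_self _).trans ((norm_le_pi_norm (h t) o).trans (hη t ht))
  obtain ⟨B, hB⟩ : ∃ B, B = (β + β * T) * Real.exp (2 * α * T) := ⟨_, rfl⟩
  have hB0 : 0 ≤ B := by rw [hB]; positivity
  obtain ⟨C, hC⟩ : ∃ C, C = (β + β * T) * Real.exp ((2 * α + η * B) * T) := ⟨_, rfl⟩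
  have hC0 : 0 ≤ C := by rw [hC]; positivity
  refine exists_solution_of_apriori_bound contDiff_diagField hT
    (p := fun t => (a t, h t, q t)) (ha.prodMk (hh.prodMk hq)) x₀ (B + C + 1) ?_
  intro τ hτ x hx0 hx
  have hsub : Icc 0 τ ⊆ Icc 0 T := Icc_subset_Icc_right hτ.2
  have hd : ∀ i, ∀ t ∈ Icc 0 τ, HasDerivWithinAt (fun t => x t i)
      (diagField ((a t, h t, q t), x t) i) (Icc 0 τ) t :=
    fun i t ht => hasDerivWithinAt_pi.1 (hx t ht) i
  have hxc : ∀ i, ContinuousOn (fun t => x t i) (Icc 0 τ) :=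
    fun i t ht => (hd i t ht).continuousWithinAt
  have hac : ContinuousOn a (Icc 0 τ) := ha.mono hsub
  have hhc : ∀ i, ContinuousOn (fun t => h t i) (Icc 0 τ) :=
    fun i => (continuousOn_pi.1 hh i).mono hsub
  have hDc : ContinuousOn (fun t => ∑ j, h t j * x t j) (Icc 0 τ) :=
    continuousOn_finsetSum _ fun j _ => (hhc j).mul (hxc j)
  have hcc : ∀ i, ContinuousOn
      (fun t => 2 * a t + h t i * x t i - 2 * ∑ j, h t j * x t j) (Icc 0 τ) := fun i =>
    ((continuousOn_const.mul hac).add ((hhc i).mul (hxc i))).sub (continuousOn_const.mul hDc)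
  have hpos : ∀ i, i ≠ o → ∀ t ∈ Icc 0 τ, 0 ≤ x t i := by
    intro i hi
    refine nonneg_of_mul_le_deriv (hd i) (hcc i) (fun t ht => ?_) (by simpa [hx0] using hxi i hi)
    have := hqi t (hsub ht) i hi
    simp only [diagField]
    linarith
  have hneg : ∀ t ∈ Icc 0 τ, 0 ≤ -x t o := by
    refine nonneg_of_mul_le_deriv (fun t ht => (hd o t ht).neg) (hcc o) (fun t ht => ?_)
      (by simpa [hx0] using hxo)
    have := hqo t (hsub ht)
    simp only [diagField]
    linarith
  have hsum : ∀ t ∈ Icc 0 τ, 0 ≤ ∑ i, x t i := by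
    refine nonneg_of_mul_le_deriv (fun t ht => HasDerivWithinAt.fun_sum fun i _ => hd i t ht)
      (c := fun t => 2 * a t - 2 * ∑ j, h t j * x t j)
      ((continuousOn_const.mul hac).sub (continuousOn_const.mul hDc)) (fun t ht => ?_)
      (by simpa [hx0] using hxs)
    have h1 := hqs t (hsub ht)
    have h2 : 0 ≤ ∑ i, h t i * x t i ^ 2 :=
      Finset.sum_nonneg fun i _ => mul_nonneg (hh0 t (hsub ht) i) (sq_nonneg _)
    simp only [diagField, Finset.sum_sub_distrib, Finset.sum_add_distrib, ← Finset.sum_mul,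
      ← Finset.mul_sum]
    linarith
  have hD : ∀ t ∈ Icc 0 τ, 0 ≤ ∑ j, h t j * x t j := by
    intro t ht
    calc 0 ≤ h t o * ∑ j, x t j := mul_nonneg (hh0 t (hsub ht) o) (hsum t ht)
      _ = ∑ j, h t o * x t j := Finset.mul_sum _ _ _
      _ ≤ ∑ j, h t j * x t j := Finset.sum_le_sum fun j _ => by
        by_cases hj : j = o
        · rw [hj]
        · exact mul_le_mul_of_nonneg_right (hho t (hsub ht) j) (hpos j hj t ht)
  have hτ0 : τ ∈ Icc 0 τ := ⟨hτ.1, le_rfl⟩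
  have hmono : ∀ c, 0 ≤ c → ∀ t ∈ Icc 0 τ,
      (β + β * t) * Real.exp (c * t) ≤ (β + β * T) * Real.exp (c * T) := by
    intro c hc t ht
    have := (hsub ht).2
    have := ht.1
    gcongr
  have hbo : ∀ t ∈ Icc 0 τ, -x t o ≤ B := by
    intro t ht
    refine (le_of_deriv_le_mul_add (b := β) (c := 2 * α) hβ0 (by positivity)
      (fun t ht => (hd o t ht).fun_neg) (fun t ht => ?_)
      (by simpa [hx0] using (neg_le_abs _).trans (hxβ o)) t ht).trans
      (hB ▸ hmono _ (by positivity) t ht)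
    have h1 := (neg_le_abs _).trans (hqβ t (hsub ht) o)
    have h2 := mul_le_mul_of_nonneg_right ((le_abs_self _).trans (hα t (hsub ht))) (hneg t ht)
    have h3 := mul_nonneg (hneg t ht) (hD t ht)
    have h4 := mul_nonneg (hh0 t (hsub ht) o) (sq_nonneg (x t o))
    simp only [diagField]
    linarith
  have hbi : ∀ i, i ≠ o → ∀ t ∈ Icc 0 τ, x t i ≤ C := by
    intro i hi t ht
    refine (le_of_deriv_le_mul_add (b := β) (c := 2 * α + η * B) hβ0 (by positivity)
      (hd i) (fun t ht => ?_)
      (by simpa [hx0] using (le_abs_self _).trans (hxβ i)) t ht).trans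
      (hC ▸ hmono _ (by positivity) t ht)
    have h1 := (le_abs_self _).trans (hqβ t (hsub ht) i)
    have hp := hpos i hi t ht
    have h2 := mul_le_mul_of_nonneg_right ((le_abs_self _).trans (hα t (hsub ht))) hp
    have h3 : h t i * x t i + h t o * x t o ≤ ∑ j, h t j * x t j := by
      rw [← Finset.sum_pair (f := fun j => h t j * x t j) hi]
      refine Finset.sum_le_sum_of_subset_of_nonneg (Finset.subset_univ _) fun j _ hj => ?_
      have hjo : j ≠ o := by
        rintro rfl
        simp at hj
      exact mul_nonneg (hh0 t (hsub ht) j) (hpos j hjo t ht)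
    have h4 : h t o * -x t o ≤ η * B :=
      mul_le_mul (hhη t (hsub ht)) (hbo t ht) (hneg t ht) hη0
    have h5 : x t i * (h t i * x t i - 2 * ∑ j, h t j * x t j) ≤ x t i * (η * B) :=
      mul_le_mul_of_nonneg_left (by linarith [hD t ht]) hp
    simp only [diagField]
    linarith
  rw [pi_norm_lt_iff (by positivity)]
  intro i
  rw [Real.norm_eq_abs, abs_lt]
  by_cases hi : i = o
  · subst hi
    have := hneg τ hτ0
    have := hbo τ hτ0
    constructor <;> linarith
  · have := hpos i hi τ hτ0
    have := hbi i hi τ hτ0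
    constructor <;> linarith

section Uniqueness

attribute [local instance] Matrix.normedAddCommGroup Matrix.normedSpace

/-- The AAO coupled Riccati vector field, as a function of the coefficients `(A, H, Q)` and the
state `S`. -/
def aaoField {n M : ℕ} (y : (Matrix (Fin n) (Fin n) ℝ × (Fin M → Matrix (Fin n) (Fin n) ℝ) ×
    (Fin M → Matrix (Fin n) (Fin n) ℝ)) × (Fin M → Matrix (Fin n) (Fin n) ℝ)) :
    Fin M → Matrix (Fin n) (Fin n) ℝ :=
  fun i => -(y.2 i * y.1.1 + y.1.1ᵀ * y.2 i + y.1.2.2 i + y.2 i * y.1.2.1 i * y.2 i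
    - ∑ j, (y.2 i * y.1.2.1 j * y.2 j + y.2 j * y.1.2.1 j * y.2 i))

lemma contDiff_matrix_entry {E : Type*} [NormedAddCommGroup E] [NormedSpace ℝ E] {n : ℕ}
    {f : E → Matrix (Fin n) (Fin n) ℝ} :
    ContDiff ℝ 1 f ↔ ∀ k l, ContDiff ℝ 1 fun x => f x k l :=
  contDiff_pi.trans (forall_congr' fun _ => contDiff_pi)

lemma ContDiff.matrix_mul {E : Type*} [NormedAddCommGroup E] [NormedSpace ℝ E] {n : ℕ}
    {f g : E → Matrix (Fin n) (Fin n) ℝ} (hf : ContDiff ℝ 1 f) (hg : ContDiff ℝ 1 g) :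
    ContDiff ℝ 1 fun x => f x * g x := by
  rw [contDiff_matrix_entry] at *
  intro k l
  simp only [Matrix.mul_apply]
  exact ContDiff.sum fun m _ => (hf k m).mul (hg m l)

lemma contDiff_aaoField {n M : ℕ} : ContDiff ℝ 1 (aaoField (n := n) (M := M)) := by
  have hA : ContDiff ℝ 1 fun y : (Matrix (Fin n) (Fin n) ℝ × (Fin M → Matrix (Fin n) (Fin n) ℝ) ×
    (Fin M → Matrix (Fin n) (Fin n) ℝ)) × (Fin M → Matrix (Fin n) (Fin n) ℝ) => y.1.1 := by
    fun_prop
  have hAt : ContDiff ℝ 1 fun y : (Matrix (Fin n) (Fin n) ℝ × (Fin M → Matrix (Fin n) (Fin n) ℝ) ×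
    (Fin M → Matrix (Fin n) (Fin n) ℝ)) × (Fin M → Matrix (Fin n) (Fin n) ℝ) => y.1.1ᵀ := by
    rw [contDiff_matrix_entry] at *
    exact fun k l => hA l k
  refine contDiff_pi.2 fun i => ?_
  have hH (i) : ContDiff ℝ 1 fun y : (Matrix (Fin n) (Fin n) ℝ × (Fin M → Matrix (Fin n) (Fin n) ℝ)
    × (Fin M → Matrix (Fin n) (Fin n) ℝ)) × (Fin M → Matrix (Fin n) (Fin n) ℝ) => y.1.2.1 i := by
    fun_prop
  have hQ (i) : ContDiff ℝ 1 fun y : (Matrix (Fin n) (Fin n) ℝ × (Fin M → Matrix (Fin n) (Fin n) ℝ)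
    × (Fin M → Matrix (Fin n) (Fin n) ℝ)) × (Fin M → Matrix (Fin n) (Fin n) ℝ) => y.1.2.2 i := by
    fun_prop
  have hS (i) : ContDiff ℝ 1 fun y : (Matrix (Fin n) (Fin n) ℝ × (Fin M → Matrix (Fin n) (Fin n) ℝ)
    × (Fin M → Matrix (Fin n) (Fin n) ℝ)) × (Fin M → Matrix (Fin n) (Fin n) ℝ) => y.2 i := by
    fun_prop
  exact ((((((hS i).matrix_mul hA).add (hAt.matrix_mul (hS i))).add (hQ i)).add
    (((hS i).matrix_mul (hH i)).matrix_mul (hS i))).sub (ContDiff.sum fun j _ =>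
      (((hS i).matrix_mul (hH j)).matrix_mul (hS j)).add
        (((hS j).matrix_mul (hH j)).matrix_mul (hS i)))).neg

lemma IsAAOSolution.hasDerivWithinAt {n M : ℕ} {A : ℝ → Matrix (Fin n) (Fin n) ℝ}
    {H Q : Fin M → ℝ → Matrix (Fin n) (Fin n) ℝ} {Sf : Fin M → Matrix (Fin n) (Fin n) ℝ}
    {a b : ℝ} {S S' : Fin M → ℝ → Matrix (Fin n) (Fin n) ℝ}
    (hS : IsAAOSolution A H Q Sf a b S S') {t : ℝ} (ht : t ∈ Icc a b) :
    HasDerivWithinAt (fun t i => S i t)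
      (aaoField ((A t, fun i => H i t, fun i => Q i t), fun i => S i t)) (Icc a b) t := by
  obtain ⟨-, hd, -, heq, -⟩ := hS
  refine hasDerivWithinAt_pi.2 fun i => ?_
  have hS' : aaoField ((A t, fun i => H i t, fun i => Q i t), fun i => S i t) i = S' i t := by
    have := heq i t ht
    rw [aaoField, neg_eq_iff_add_eq_zero, ← this]
    simp only
    abel
  rw [hS']
  exact hasDerivWithinAt_pi.2 fun k => hasDerivWithinAt_pi.2 fun l => hd i t ht k l

/-- Solution sets of the AAO coupled Riccati equations are unique. -/
lemma IsAAOSolution.eq {n M : ℕ} {A : ℝ → Matrix (Fin n) (Fin n) ℝ}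
    {H Q : Fin M → ℝ → Matrix (Fin n) (Fin n) ℝ} {Sf : Fin M → Matrix (Fin n) (Fin n) ℝ}
    {a b : ℝ} {S S' T T' : Fin M → ℝ → Matrix (Fin n) (Fin n) ℝ}
    (hA : ∀ k l, ContinuousOn (fun t => A t k l) (Icc a b))
    (hH : ∀ i k l, ContinuousOn (fun t => H i t k l) (Icc a b))
    (hQ : ∀ i k l, ContinuousOn (fun t => Q i t k l) (Icc a b))
    (hS : IsAAOSolution A H Q Sf a b S S') (hT : IsAAOSolution A H Q Sf a b T T') (i : Fin M)
    {t : ℝ} (ht : t ∈ Icc a b) : T i t = S i t := by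
  have hp : ContinuousOn (fun t => (A t, (fun i => H i t), fun i => Q i t)) (Icc a b) := by
    refine ContinuousOn.prodMk ?_ (ContinuousOn.prodMk ?_ ?_)
    · exact continuousOn_pi.2 fun k => continuousOn_pi.2 fun l => hA k l
    · exact continuousOn_pi.2 fun i => continuousOn_pi.2 fun k => continuousOn_pi.2 fun l => hH i k l
    · exact continuousOn_pi.2 fun i => continuousOn_pi.2 fun k => continuousOn_pi.2 fun l => hQ i k l
  have hcS : ContinuousOn (fun t i => S i t) (Icc a b) :=
    fun t ht => (hS.hasDerivWithinAt ht).continuousWithinAt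
  have hcT : ContinuousOn (fun t i => T i t) (Icc a b) :=
    fun t ht => (hT.hasDerivWithinAt ht).continuousWithinAt
  obtain ⟨R₁, hR₁⟩ := isCompact_Icc.exists_bound_of_continuousOn hcS
  obtain ⟨R₂, hR₂⟩ := isCompact_Icc.exists_bound_of_continuousOn hcT
  obtain ⟨K, hK⟩ := exists_lipschitzOnWith_closedBall contDiff_aaoField hp (max R₁ R₂)
  refine congrFun (ODE_solution_unique_of_mem_Icc_left (s := fun _ => closedBall 0 (max R₁ R₂))
    (fun t ht => hK t (Ioc_subset_Icc_self ht)) hcT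
    (fun t ht => (hT.hasDerivWithinAt (Ioc_subset_Icc_self ht)).mono_of_mem_nhdsWithin
      (Icc_mem_nhdsLE_of_mem ht))
    (fun t ht => ?_) hcS
    (fun t ht => (hS.hasDerivWithinAt (Ioc_subset_Icc_self ht)).mono_of_mem_nhdsWithin
      (Icc_mem_nhdsLE_of_mem ht))
    (fun t ht => ?_) ?_ ht) i
  · simpa using Or.inr (hR₂ t (Ioc_subset_Icc_self ht))
  · simpa using Or.inl (hR₁ t (Ioc_subset_Icc_self ht))
  · funext i
    rw [hS.2.2.2.2 i, hT.2.2.2.2 i]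

end Uniqueness

/-- For diagonal data, solutions of the decoupled scalar systems assemble to a solution set of the
AAO coupled Riccati equations. -/
lemma isAAOSolution_diagonal {n M : ℕ} {t₀ tf : ℝ} {A : ℝ → Matrix (Fin n) (Fin n) ℝ}
    {H Q : Fin M → ℝ → Matrix (Fin n) (Fin n) ℝ} {Sf : Fin M → Matrix (Fin n) (Fin n) ℝ}
    (hAc : ∀ k l, ContinuousOn (fun t => A t k l) (Icc t₀ tf))
    (hHc : ∀ i k l, ContinuousOn (fun t => H i t k l) (Icc t₀ tf))
    (hQc : ∀ i k l, ContinuousOn (fun t => Q i t k l) (Icc t₀ tf))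
    (hA : ∀ t ∈ Icc t₀ tf, (A t).IsDiag) (hH : ∀ i, ∀ t ∈ Icc t₀ tf, (H i t).IsDiag)
    (hQ : ∀ i, ∀ t ∈ Icc t₀ tf, (Q i t).IsDiag) (hSf : ∀ i, (Sf i).IsDiag)
    {s : Fin n → ℝ → Fin M → ℝ} (hs0 : ∀ k, s k tf = fun i => Sf i k k)
    (hs : ∀ k, ∀ t ∈ Icc t₀ tf, HasDerivWithinAt (s k)
      (-diagField ((A t k k, (fun i => H i t k k), fun i => Q i t k k), s k t)) (Icc t₀ tf) t) :
    IsAAOSolution A H Q Sf t₀ tf (fun i t => diagonal fun k => s k t i)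
      (fun i t => diagonal fun k =>
        -diagField ((A t k k, (fun i => H i t k k), fun i => Q i t k k), s k t) i) := by
  have hsc : ∀ k, ContinuousOn (s k) (Icc t₀ tf) := fun k t ht =>
    (hs k t ht).continuousWithinAt
  refine ⟨fun i t _ => isSymm_diagonal _, fun i t ht k l => ?_, fun i k l => ?_, fun i t ht => ?_,
    fun i => ?_⟩
  · by_cases hkl : k = l
    · subst hkl
      simpa using hasDerivWithinAt_pi.1 (hs k t ht) i
    · simpa [diagonal_apply_ne _ hkl] using hasDerivWithinAt_const t (Icc t₀ tf) (0 : ℝ)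
  · by_cases hkl : k = l
    · subst hkl
      simp only [diagonal_apply_eq]
      exact (continuousOn_pi.1 (contDiff_diagField.continuous.comp_continuousOn
        (((hAc k k).prodMk ((continuousOn_pi.2 fun i => hHc i k k).prodMk
          (continuousOn_pi.2 fun i => hQc i k k))).prodMk (hsc k))) i).neg
    · simpa [diagonal_apply_ne _ hkl] using continuousOn_const
  · obtain ⟨α, hα⟩ : ∃ α, A t = Matrix.diagonal α := ⟨_, (hA t ht).diagonal_diag.symm⟩
    obtain ⟨θ, hθ⟩ : ∃ θ : Fin M → Fin n → ℝ, ∀ j, H j t = Matrix.diagonal (θ j) :=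
      ⟨_, fun j => (hH j t ht).diagonal_diag.symm⟩
    obtain ⟨κ, hκ⟩ : ∃ κ, Q i t = Matrix.diagonal κ := ⟨_, (hQ i t ht).diagonal_diag.symm⟩
    ext k l
    by_cases hkl : k = l
    · subst hkl
      simp only [hα, hθ, hκ, diagField, diagonal_apply_eq, diagonal_mul_diagonal,
        diagonal_transpose, Matrix.add_apply, Matrix.sub_apply, Matrix.sum_apply, Matrix.zero_apply]
      have hsum : ∑ j, (s k t i * θ j k * s k t j + s k t j * θ j k * s k t i) =
          2 * s k t i * ∑ j, θ j k * s k t j := by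
        rw [Finset.mul_sum]
        exact Finset.sum_congr rfl fun j _ => by ring
      rw [hsum]
      ring
    · simp [hα, hθ, hκ, Matrix.sum_apply, diagonal_apply_ne _ hkl]
  · rw [← (hSf i).diagonal_diag]
    simp [hs0, Matrix.diag]

/-- **Corollary 1 (existence for the diagonal AAO game).**  If all the data
matrices are diagonal, `Q_1(t) + Σ_{i≥2} Q_i(t) ≻ 0` for all `t`,
`S_{1f} + Σ_{i≥2} S_{if} ≻ 0`, and `H_1(t) ⪯ H_i(t)` for `i ≥ 2`, then the AAO
coupled Riccati equations have a unique solution set on `[t_0, t_f]`. -/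
theorem aao_diagonal_existence_uniqueness {n M : ℕ} [NeZero M]
    (hn : 1 ≤ n) (hM : 2 ≤ M)
    {t0 tf : ℝ} (ht : t0 < tf)
    (A : ℝ → Matrix (Fin n) (Fin n) ℝ)
    (H Q : Fin M → ℝ → Matrix (Fin n) (Fin n) ℝ)
    (Sf : Fin M → Matrix (Fin n) (Fin n) ℝ)
    (hAcont : ∀ k l, ContinuousOn (fun t => A t k l) (Icc t0 tf))
    (hHcont : ∀ i k l, ContinuousOn (fun t => H i t k l) (Icc t0 tf))
    (hQcont : ∀ i k l, ContinuousOn (fun t => Q i t k l) (Icc t0 tf))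
    (hHpsd : ∀ i, ∀ t ∈ Icc t0 tf, (H i t).PosSemidef)
    (hQ1 : ∀ t ∈ Icc t0 tf, (-(Q 0 t)).PosDef)
    (hQi : ∀ i : Fin M, i ≠ 0 → ∀ t ∈ Icc t0 tf, (Q i t).PosSemidef)
    (hSf1 : (-(Sf 0)).PosDef)
    (hSfi : ∀ i : Fin M, i ≠ 0 → (Sf i).PosSemidef)
    (hAdiag : ∀ t ∈ Icc t0 tf, (A t).IsDiag)
    (hHdiag : ∀ i, ∀ t ∈ Icc t0 tf, (H i t).IsDiag)
    (hQdiag : ∀ i, ∀ t ∈ Icc t0 tf, (Q i t).IsDiag)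
    (hSfdiag : ∀ i, (Sf i).IsDiag)
    (hQsum : ∀ t ∈ Icc t0 tf,
      (Q 0 t + ∑ i ∈ Finset.univ.erase 0, Q i t).PosDef)
    (hSfsum : (Sf 0 + ∑ i ∈ Finset.univ.erase 0, Sf i).PosDef)
    (hH1le : ∀ i : Fin M, i ≠ 0 → ∀ t ∈ Icc t0 tf, (H i t - H 0 t).PosSemidef) :
    ∃ S S' : Fin M → ℝ → Matrix (Fin n) (Fin n) ℝ,
      IsAAOSolution A H Q Sf t0 tf S S' ∧
      ∀ T T' : Fin M → ℝ → Matrix (Fin n) (Fin n) ℝ,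
        IsAAOSolution A H Q Sf t0 tf T T' →
        ∀ i, ∀ t ∈ Icc t0 tf, T i t = S i t := by
  have hT : 0 ≤ tf - t0 := sub_nonneg.2 ht.le
  have hmaps : MapsTo (fun t => tf - t) (Icc 0 (tf - t0)) (Icc t0 tf) := fun t ht =>
    ⟨by linarith [ht.2], by linarith [ht.1]⟩
  have hmaps' : MapsTo (fun t => tf - t) (Icc t0 tf) (Icc 0 (tf - t0)) := fun t ht =>
    ⟨by linarith [ht.2], by linarith [ht.1]⟩
  have hrev : ∀ {f : ℝ → ℝ}, ContinuousOn f (Icc t0 tf) →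
      ContinuousOn (fun t => f (tf - t)) (Icc 0 (tf - t0)) := fun hf =>
    hf.comp (continuousOn_const.sub continuousOn_id) hmaps
  have hx : ∀ k, ∃ x : ℝ → Fin M → ℝ, x 0 = (fun i => Sf i k k) ∧
      ∀ t ∈ Icc 0 (tf - t0), HasDerivWithinAt x
        (diagField ((A (tf - t) k k, (fun i => H i (tf - t) k k), fun i => Q i (tf - t) k k), x t))
        (Icc 0 (tf - t0)) t := by
    intro k
    refine exists_diagField_solution (0 : Fin M) hT (hrev (hAcont k k))
      (continuousOn_pi.2 fun i => hrev (hHcont i k k))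
      (continuousOn_pi.2 fun i => hrev (hQcont i k k))
      (fun t ht i => (hHpsd i _ (hmaps ht)).diag_nonneg) (fun t ht i => ?_) (fun t ht => ?_)
      (fun t ht i hi => (hQi i hi _ (hmaps ht)).diag_nonneg) (fun t ht => ?_) ?_
      (fun i hi => (hSfi i hi).diag_nonneg) ?_
    · by_cases hi : i = 0
      · rw [hi]
      · exact sub_nonneg.1 (hH1le i hi _ (hmaps ht)).diag_nonneg
    · exact (neg_pos.1 (hQ1 _ (hmaps ht)).diag_pos).le
    · rw [← Finset.add_sum_erase _ _ (Finset.mem_univ (0 : Fin M))]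
      simpa [Matrix.sum_apply] using (hQsum _ (hmaps ht)).posSemidef.diag_nonneg (i := k)
    · exact (neg_pos.1 hSf1.diag_pos).le
    · rw [← Finset.add_sum_erase _ _ (Finset.mem_univ (0 : Fin M))]
      simpa [Matrix.sum_apply] using hSfsum.posSemidef.diag_nonneg (i := k)
  choose x hx0 hx using hx
  have hsol := isAAOSolution_diagonal hAcont hHcont hQcont hAdiag hHdiag hQdiag hSfdiag
    (s := fun k t => x k (tf - t)) (fun k => by simp [hx0]) (fun k t ht => by
      have h1 : HasDerivWithinAt (fun t => tf - t) (-1) (Icc t0 tf) t :=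
        (hasDerivWithinAt_id t _).const_sub tf
      have h2 := (hx k _ (hmaps' ht)).scomp t h1 hmaps'
      simp only [sub_sub_cancel, neg_smul, one_smul] at h2
      exact h2)
  exact ⟨_, _, hsol, fun T T' hT i t ht => hsol.eq hAcont hHcont hQcont hT i ht⟩
end

section
/- (Lower bound on ℛ_Q for diagonal data, inequalities (28)–(31)) Let Q, H_1, …, H_M, W_1, …, W_M be diagonal n×n real matrices with Q ⪰ 0, H_i ⪰ 0 for all i, H_1 ⪯ H_i for i = 2, …, M, W_1 ⪯ 0, and W_i ⪰ 0 for i = 2, …, M. Define ℛ_Q(W_1, …, W_M) = Q + W_1 H_1 W_1 − Σ_{i=2}^M W_i H_i W_i + (−W_1 + Σ_{i=2}^M W_i)·Σ_{j=1}^M H_j W_j + Σ_{j=1}^M W_j H_j·(−W_1 + Σ_{i=2}^M W_i). Then ℛ_Q(W_1, …, W_M) ⪰ H_1 · (−W_1 + Σ_{i=2}^M W_i) · (W_1 + Σ_{i=2}^M W_i). In particular, if additionally W_1 + Σ_{i=2}^M W_i ⪰ 0, then ℛ_Q(W_1, …, W_M) ⪰ 0. -/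
open Matrix

/-- The map `ℛ_Q` for constant diagonal data.  Players are indexed by `Fin M`,
index `0` being player 1 (the opposing player). -/
def RQconst {n M : ℕ} [NeZero M] (Qc : Matrix (Fin n) (Fin n) ℝ)
    (H W : Fin M → Matrix (Fin n) (Fin n) ℝ) : Matrix (Fin n) (Fin n) ℝ :=
  Qc + W 0 * H 0 * W 0 - ∑ i ∈ Finset.univ.erase 0, W i * H i * W i
    + (-(W 0) + ∑ i ∈ Finset.univ.erase 0, W i) * (∑ j, H j * W j)
    + (∑ j, W j * H j) * (-(W 0) + ∑ i ∈ Finset.univ.erase 0, W i)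

/-- The scalar version of the lower bound, with the opposing player's data `h₀`, `w₀` singled
out from those of the players in `s`. -/
theorem rq_scalar_lower_bound {ι : Type*} (s : Finset ι) (q h₀ w₀ : ℝ) (h w : ι → ℝ)
    (hq : 0 ≤ q) (hh₀ : 0 ≤ h₀) (hle : ∀ i ∈ s, h₀ ≤ h i) (hw₀ : w₀ ≤ 0)
    (hw : ∀ i ∈ s, 0 ≤ w i) :
    h₀ * (-w₀ + ∑ i ∈ s, w i) * (w₀ + ∑ i ∈ s, w i) ≤
      q + w₀ * h₀ * w₀ - ∑ i ∈ s, w i * h i * w i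
        + (-w₀ + ∑ i ∈ s, w i) * (h₀ * w₀ + ∑ i ∈ s, h i * w i)
        + (w₀ * h₀ + ∑ i ∈ s, w i * h i) * (-w₀ + ∑ i ∈ s, w i) := by
  have hcomm : ∑ i ∈ s, w i * h i = ∑ i ∈ s, h i * w i :=
    Finset.sum_congr rfl fun i _ => mul_comm _ _
  have hS : 0 ≤ ∑ i ∈ s, w i := Finset.sum_nonneg hw
  have hT : h₀ * ∑ i ∈ s, w i ≤ ∑ i ∈ s, h i * w i := by
    rw [Finset.mul_sum]
    exact Finset.sum_le_sum fun i hi => mul_le_mul_of_nonneg_right (hle i hi) (hw i hi)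
  have hquad : ∑ i ∈ s, w i * h i * w i ≤ (∑ i ∈ s, h i * w i) * ∑ i ∈ s, w i := by
    rw [Finset.sum_mul]
    refine Finset.sum_le_sum fun i hi => ?_
    rw [mul_comm (w i) (h i)]
    exact mul_le_mul_of_nonneg_left (Finset.single_le_sum hw hi)
      (mul_nonneg (hh₀.trans (hle i hi)) (hw i hi))
  rw [hcomm]
  nlinarith [mul_nonneg hS (sub_nonneg.2 hT), mul_nonneg (neg_nonneg.2 hw₀) (sub_nonneg.2 hT)]

theorem Matrix.diagonal_finset_sum {ι m R : Type*} [DecidableEq m] [AddCommMonoid R]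
    (s : Finset ι) (d : ι → m → R) :
    ∑ i ∈ s, diagonal (d i) = diagonal (∑ i ∈ s, d i) :=
  (map_sum (diagonalAddMonoidHom m R) d s).symm

/-- **Lower bound on `ℛ_Q` for diagonal data (inequalities (28)–(31)).**
For diagonal matrices with `Q ⪰ 0`, `H_i ⪰ 0`, `H_1 ⪯ H_i` (`i ≥ 2`), `W_1 ⪯ 0`
and `W_i ⪰ 0` (`i ≥ 2`),
`ℛ_Q(W_1,…,W_M) ⪰ H_1 (−W_1 + Σ_{i≥2} W_i)(W_1 + Σ_{i≥2} W_i)`;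
in particular `ℛ_Q(W_1,…,W_M) ⪰ 0` whenever `W_1 + Σ_{i≥2} W_i ⪰ 0`. -/
theorem rq_diagonal_lower_bound {n M : ℕ} [NeZero M] (hn : 1 ≤ n) (hM : 2 ≤ M)
    (Qc : Matrix (Fin n) (Fin n) ℝ) (H W : Fin M → Matrix (Fin n) (Fin n) ℝ)
    (hQdiag : Qc.IsDiag) (hHdiag : ∀ i, (H i).IsDiag) (hWdiag : ∀ i, (W i).IsDiag)
    (hQpsd : Qc.PosSemidef) (hHpsd : ∀ i, (H i).PosSemidef)
    (hH1le : ∀ i : Fin M, i ≠ 0 → (H i - H 0).PosSemidef)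
    (hW1 : (-(W 0)).PosSemidef)
    (hWi : ∀ i : Fin M, i ≠ 0 → (W i).PosSemidef) :
    (RQconst Qc H W
      - H 0 * (-(W 0) + ∑ i ∈ Finset.univ.erase 0, W i)
          * (W 0 + ∑ i ∈ Finset.univ.erase 0, W i)).PosSemidef ∧
    ((W 0 + ∑ i ∈ Finset.univ.erase 0, W i).PosSemidef →
      (RQconst Qc H W).PosSemidef) := by
  have key : (RQconst Qc H W
      - H 0 * (-(W 0) + ∑ i ∈ Finset.univ.erase 0, W i)
          * (W 0 + ∑ i ∈ Finset.univ.erase 0, W i)).PosSemidef := by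
    obtain ⟨q, rfl⟩ : ∃ q, Qc = diagonal q := ⟨_, hQdiag.diagonal_diag.symm⟩
    obtain ⟨h, rfl⟩ : ∃ h : Fin M → Fin n → ℝ, H = fun i => diagonal (h i) :=
      ⟨_, funext fun i => (hHdiag i).diagonal_diag.symm⟩
    obtain ⟨w, rfl⟩ : ∃ w : Fin M → Fin n → ℝ, W = fun i => diagonal (w i) :=
      ⟨_, funext fun i => (hWdiag i).diagonal_diag.symm⟩
    simp only [diagonal_sub, diagonal_neg, posSemidef_diagonal_iff] at hQpsd hHpsd hH1le hW1 hWi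
    simp only [RQconst, diagonal_mul_diagonal, diagonal_finset_sum, diagonal_sub, diagonal_neg,
      diagonal_add, posSemidef_diagonal_iff]
    intro k
    have hscalar := rq_scalar_lower_bound (Finset.univ.erase (0 : Fin M)) (q k) (h 0 k) (w 0 k)
      (fun i => h i k) (fun i => w i k) (hQpsd k) (hHpsd 0 k)
      (fun i hi => sub_nonneg.1 (hH1le i (Finset.ne_of_mem_erase hi) k))
      (neg_nonneg.1 (hW1 k)) (fun i hi => hWi i (Finset.ne_of_mem_erase hi) k)
    rw [Finset.add_sum_erase _ (fun i => h i k * w i k) (Finset.mem_univ 0),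
      Finset.add_sum_erase _ (fun i => w i k * h i k) (Finset.mem_univ 0)] at hscalar
    simpa only [Finset.sum_apply, Pi.neg_apply, sub_nonneg] using hscalar
  refine ⟨key, fun hsum => ?_⟩
  have hdiff : (-(W 0) + ∑ i ∈ Finset.univ.erase 0, W i).PosSemidef :=
    hW1.add (posSemidef_sum _ fun i hi => hWi i (Finset.ne_of_mem_erase hi))
  have hprod : (H 0 * (-(W 0) + ∑ i ∈ Finset.univ.erase 0, W i)
      * (W 0 + ∑ i ∈ Finset.univ.erase 0, W i)).PosSemidef := by
    have hSdiag : (∑ i ∈ Finset.univ.erase 0, W i).IsDiag := fun a b hab => by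
      simp only [Matrix.sum_apply]
      exact Finset.sum_eq_zero fun i _ => hWdiag i hab
    rw [← ((hWdiag 0).add hSdiag).diagonal_diag] at hsum ⊢
    rw [← ((hWdiag 0).neg.add hSdiag).diagonal_diag] at hdiff ⊢
    have hH0 := hHpsd 0
    rw [← (hHdiag 0).diagonal_diag] at hH0 ⊢
    rw [posSemidef_diagonal_iff] at hsum hdiff hH0
    rw [diagonal_mul_diagonal, diagonal_mul_diagonal, posSemidef_diagonal_iff]
    exact fun k => mul_nonneg (mul_nonneg (hH0 k) (hdiff k)) (hsum k)
  simpa only [sub_add_cancel] using key.add hprod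
end

section
/- (Exponential decay bounds in the proof of Theorem 3) Suppose Q_1(t) + Σ_{i=2}^M Q_i(t) is positive definite for every t ∈ [t_0, t_f] and S_{1f} + Σ_{i=2}^M S_{if} is positive definite, and let {S_1, …, S_M} be a solution set of the AAO coupled Riccati equations on [t_0, t_f]. Define P(t) = Σ_{i=1}^M S_i(t), Ā(t) = A(t) − Σ_{j=1}^M H_j(t) S_j(t), Q̂(t) = Σ_{i=1}^M Q_i(t), λ̲_{Q̂} = min_{t ∈ [t_0,t_f]} λ_min(Q̂(t)) > 0, λ̄_P = max_{t ∈ [t_0,t_f]} λ_max(P(t)), and λ̲_P = min_{t ∈ [t_0,t_f]} λ_min(P(t)) > 0. Let x : [t_0, t_f] → ℝⁿ solve ẋ(t) = Ā(t) x(t) with x(t_0) = x_0, and set V(t) = x(t)ᵀP(t)x(t). Then for all t ∈ [t_0, t_f]: V(t) ≤ V(t_0) · exp( −(λ̲_{Q̂}/λ̄_P)(t − t_0) ) and ‖x(t)‖² ≤ ‖x_0‖² · (λ̄_P/λ̲_P) · exp( −(λ̲_{Q̂}/λ̄_P)(t − t_0) ). -/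
open Matrix Set

/-- The largest eigenvalue of a symmetric real matrix, as the supremum of the
Rayleigh quotient over the unit sphere. -/
noncomputable def lamMax {n : ℕ} (X : Matrix (Fin n) (Fin n) ℝ) : ℝ :=
  sSup {r : ℝ | ∃ v : Fin n → ℝ, v ⬝ᵥ v = 1 ∧ r = v ⬝ᵥ X.mulVec v}

/-- The smallest eigenvalue of a symmetric real matrix, as the infimum of the
Rayleigh quotient over the unit sphere. -/
noncomputable def lamMin {n : ℕ} (X : Matrix (Fin n) (Fin n) ℝ) : ℝ :=
  sInf {r : ℝ | ∃ v : Fin n → ℝ, v ⬝ᵥ v = 1 ∧ r = v ⬝ᵥ X.mulVec v}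

section QuadraticForms

variable {n : ℕ}

theorem isCompact_setOf_dotProduct_self_eq_one_s15 :
    IsCompact {v : Fin n → ℝ | v ⬝ᵥ v = 1} := by
  refine (isCompact_Icc (a := fun _ : Fin n => (-1 : ℝ)) (b := fun _ => 1)).of_isClosed_subset
    (isClosed_eq (by simp only [dotProduct]; fun_prop) continuous_const) ?_
  intro v hv
  have h : ∀ k, v k * v k ≤ 1 := fun k =>
    (Finset.single_le_sum (f := fun k => v k * v k) (fun j _ => mul_self_nonneg _)
      (Finset.mem_univ k)).trans_eq hv
  exact ⟨fun k => (by nlinarith [h k] : -1 ≤ v k), fun k => (by nlinarith [h k] : v k ≤ 1)⟩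

theorem exists_dotProduct_self_eq_one (hn : 1 ≤ n) : ∃ v : Fin n → ℝ, v ⬝ᵥ v = 1 :=
  ⟨Pi.single ⟨0, hn⟩ 1, by simp⟩

theorem exists_smul_dotProduct_self_eq_one {v : Fin n → ℝ} (hv : v ≠ 0) :
    ∃ (c : ℝ) (u : Fin n → ℝ), v = c • u ∧ u ⬝ᵥ u = 1 := by
  have hpos : 0 < v ⬝ᵥ v :=
    lt_of_le_of_ne (Finset.sum_nonneg fun k _ => mul_self_nonneg (v k))
      fun h => hv (dotProduct_self_eq_zero.mp h.symm)
  have hs : √(v ⬝ᵥ v) ≠ 0 := (Real.sqrt_pos.mpr hpos).ne'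
  refine ⟨√(v ⬝ᵥ v), (√(v ⬝ᵥ v))⁻¹ • v, by rw [smul_smul, mul_inv_cancel₀ hs, one_smul], ?_⟩
  rw [smul_dotProduct, dotProduct_smul, smul_eq_mul, smul_eq_mul]
  nth_rewrite 3 [← Real.mul_self_sqrt hpos.le]
  field_simp

theorem continuousOn_quadratic {s : Set ℝ} {X : ℝ → Matrix (Fin n) (Fin n) ℝ}
    (hX : ∀ k l, ContinuousOn (fun t => X t k l) s) (K : Set (Fin n → ℝ)) :
    ContinuousOn (fun p : ℝ × (Fin n → ℝ) => p.2 ⬝ᵥ (X p.1).mulVec p.2) (s ×ˢ K) := by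
  simp only [dotProduct, mulVec]
  refine continuousOn_finsetSum _ fun k _ => ContinuousOn.mul (by fun_prop) ?_
  refine continuousOn_finsetSum _ fun l _ => ContinuousOn.mul ?_ (by fun_prop)
  exact (hX k l).comp continuousOn_fst fun p hp => hp.1

theorem hasDerivWithinAt_quadratic {s : Set ℝ} {t : ℝ} {X : ℝ → Matrix (Fin n) (Fin n) ℝ}
    {X' : Matrix (Fin n) (Fin n) ℝ} {x : ℝ → Fin n → ℝ} {x' : Fin n → ℝ}
    (hX : ∀ k l, HasDerivWithinAt (fun r => X r k l) (X' k l) s t)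
    (hx : ∀ k, HasDerivWithinAt (fun r => x r k) (x' k) s t) :
    HasDerivWithinAt (fun r => x r ⬝ᵥ (X r).mulVec (x r))
      (x' ⬝ᵥ (X t).mulVec (x t) + x t ⬝ᵥ X'.mulVec (x t) + x t ⬝ᵥ (X t).mulVec x') s t := by
  have h := HasDerivWithinAt.fun_sum (u := Finset.univ) fun k _ =>
    (hx k).fun_mul (HasDerivWithinAt.fun_sum (u := Finset.univ) fun l _ =>
      (hX k l).fun_mul (hx l))
  refine h.congr_deriv ?_
  simp only [dotProduct, mulVec, Finset.sum_add_distrib, mul_add, add_assoc]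

section Bounds

variable {a b : ℝ} {X : ℝ → Matrix (Fin n) (Fin n) ℝ}

theorem exists_abs_quadratic_le (hX : ∀ k l, ContinuousOn (fun t => X t k l) (Icc a b)) :
    ∃ C, ∀ t ∈ Icc a b, ∀ v : Fin n → ℝ, v ⬝ᵥ v = 1 → |v ⬝ᵥ (X t).mulVec v| ≤ C := by
  obtain ⟨C, hC⟩ := (isCompact_Icc.prod
    isCompact_setOf_dotProduct_self_eq_one_s15).exists_bound_of_continuousOn
      (continuousOn_quadratic hX _)
  exact ⟨C, fun t ht v hv => hC (t, v) ⟨ht, hv⟩⟩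

theorem sInf_lamMin_mul_le (hn : 1 ≤ n)
    (hX : ∀ k l, ContinuousOn (fun t => X t k l) (Icc a b)) {t : ℝ} (ht : t ∈ Icc a b)
    (v : Fin n → ℝ) :
    sInf ((fun t => lamMin (X t)) '' Icc a b) * (v ⬝ᵥ v) ≤ v ⬝ᵥ (X t).mulVec v := by
  obtain ⟨C, hC⟩ := exists_abs_quadratic_le hX
  obtain ⟨u₀, hu₀⟩ := exists_dotProduct_self_eq_one hn
  have hunit : ∀ u : Fin n → ℝ, u ⬝ᵥ u = 1 →
      sInf ((fun t => lamMin (X t)) '' Icc a b) ≤ u ⬝ᵥ (X t).mulVec u := by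
    intro u hu
    refine (csInf_le ⟨-C, ?_⟩ (mem_image_of_mem _ ht)).trans (csInf_le ⟨-C, ?_⟩ ⟨u, hu, rfl⟩)
    · rintro _ ⟨r, hr, rfl⟩
      refine le_csInf ⟨_, u₀, hu₀, rfl⟩ ?_
      rintro _ ⟨w, hw, rfl⟩
      exact (abs_le.mp (hC r hr w hw)).1
    · rintro _ ⟨w, hw, rfl⟩
      exact (abs_le.mp (hC t ht w hw)).1
  rcases eq_or_ne v 0 with rfl | hv
  · simp
  · obtain ⟨c, u, rfl, hu⟩ := exists_smul_dotProduct_self_eq_one hv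
    simp only [mulVec_smul, smul_dotProduct, dotProduct_smul, smul_eq_mul, hu]
    nlinarith [mul_le_mul_of_nonneg_left (hunit u hu) (mul_self_nonneg c)]

theorem le_sSup_lamMax_mul (hn : 1 ≤ n)
    (hX : ∀ k l, ContinuousOn (fun t => X t k l) (Icc a b)) {t : ℝ} (ht : t ∈ Icc a b)
    (v : Fin n → ℝ) :
    v ⬝ᵥ (X t).mulVec v ≤ sSup ((fun t => lamMax (X t)) '' Icc a b) * (v ⬝ᵥ v) := by
  obtain ⟨C, hC⟩ := exists_abs_quadratic_le hX
  obtain ⟨u₀, hu₀⟩ := exists_dotProduct_self_eq_one hn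
  have hunit : ∀ u : Fin n → ℝ, u ⬝ᵥ u = 1 →
      u ⬝ᵥ (X t).mulVec u ≤ sSup ((fun t => lamMax (X t)) '' Icc a b) := by
    intro u hu
    refine le_trans (b := lamMax (X t)) (le_csSup ⟨C, ?_⟩ ⟨u, hu, rfl⟩)
      (le_csSup ⟨C, ?_⟩ ⟨t, ht, rfl⟩)
    · rintro _ ⟨w, hw, rfl⟩
      exact (abs_le.mp (hC t ht w hw)).2
    · rintro _ ⟨r, hr, rfl⟩
      refine csSup_le ⟨_, u₀, hu₀, rfl⟩ ?_
      rintro _ ⟨w, hw, rfl⟩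
      exact (abs_le.mp (hC r hr w hw)).2
  rcases eq_or_ne v 0 with rfl | hv
  · simp
  · obtain ⟨c, u, rfl, hu⟩ := exists_smul_dotProduct_self_eq_one hv
    simp only [mulVec_smul, smul_dotProduct, dotProduct_smul, smul_eq_mul, hu]
    nlinarith [mul_le_mul_of_nonneg_left (hunit u hu) (mul_self_nonneg c)]

theorem sInf_lamMin_pos (hn : 1 ≤ n) (hab : a ≤ b)
    (hX : ∀ k l, ContinuousOn (fun t => X t k l) (Icc a b))
    (hpos : ∀ t ∈ Icc a b, ∀ v : Fin n → ℝ, v ≠ 0 → 0 < v ⬝ᵥ (X t).mulVec v) :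
    0 < sInf ((fun t => lamMin (X t)) '' Icc a b) := by
  obtain ⟨u₀, hu₀⟩ := exists_dotProduct_self_eq_one hn
  obtain ⟨⟨s, w⟩, ⟨hs, hw⟩, hmin⟩ := (isCompact_Icc.prod
    isCompact_setOf_dotProduct_self_eq_one_s15).exists_isMinOn
      ⟨(a, u₀), left_mem_Icc.mpr hab, hu₀⟩ (continuousOn_quadratic hX _)
  have hw0 : w ≠ 0 := by
    rintro rfl
    simp at hw
  refine (hpos s hs w hw0).trans_le (le_csInf ⟨_, a, left_mem_Icc.mpr hab, rfl⟩ ?_)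
  rintro _ ⟨t, ht, rfl⟩
  refine le_csInf ⟨_, u₀, hu₀, rfl⟩ ?_
  rintro _ ⟨v, hv, rfl⟩
  exact hmin (show (t, v) ∈ _ from ⟨ht, hv⟩)

/-- A differentiable family of symmetric matrices that is positive at the right end point and
strictly decreasing along its own kernel is positive throughout. -/
theorem quadratic_pos_of_deriv_neg_on_ker {X' : ℝ → Matrix (Fin n) (Fin n) ℝ}
    (hsymm : ∀ t ∈ Icc a b, (X t).IsSymm)
    (hX : ∀ t ∈ Icc a b, ∀ k l, HasDerivWithinAt (fun s => X s k l) (X' t k l) (Icc a b) t)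
    (hker : ∀ t ∈ Icc a b, ∀ v : Fin n → ℝ, v ≠ 0 → (X t).mulVec v = 0 →
      v ⬝ᵥ (X' t).mulVec v < 0)
    (hb : ∀ v : Fin n → ℝ, v ≠ 0 → 0 < v ⬝ᵥ (X b).mulVec v) {t : ℝ} (ht : t ∈ Icc a b)
    {v : Fin n → ℝ} (hv : v ≠ 0) : 0 < v ⬝ᵥ (X t).mulVec v := by
  have hcont : ∀ k l, ContinuousOn (fun t => X t k l) (Icc a b) := fun k l s hs =>
    (hX s hs k l).continuousWithinAt
  have hderiv : ∀ s ∈ Icc a b, ∀ w : Fin n → ℝ,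
      HasDerivWithinAt (fun r => w ⬝ᵥ (X r).mulVec w) (w ⬝ᵥ (X' s).mulVec w) (Icc a b) s :=
    fun s hs w => (hasDerivWithinAt_quadratic (x := fun _ => w) (x' := 0) (hX s hs)
      fun k => hasDerivWithinAt_const ..).congr_deriv (by simp)
  have key : ¬ ∃ s ∈ Icc a b, ∃ w : Fin n → ℝ, w ⬝ᵥ w = 1 ∧ w ⬝ᵥ (X s).mulVec w ≤ 0 := by
    rintro ⟨s₀, hs₀, w₀, hw₀, hle₀⟩
    have hK : IsCompact ((Icc a b ×ˢ {w : Fin n → ℝ | w ⬝ᵥ w = 1}) ∩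
        (fun p : ℝ × (Fin n → ℝ) => p.2 ⬝ᵥ (X p.1).mulVec p.2) ⁻¹' Iic 0) :=
      (isCompact_Icc.prod isCompact_setOf_dotProduct_self_eq_one_s15).of_isClosed_subset
        ((continuousOn_quadratic hcont _).preimage_isClosed_of_isClosed
          (isCompact_Icc.prod isCompact_setOf_dotProduct_self_eq_one_s15).isClosed isClosed_Iic)
        inter_subset_left
    obtain ⟨⟨s, w⟩, ⟨⟨hs, hw⟩, hle⟩, hmax⟩ :=
      hK.exists_isMaxOn ⟨(s₀, w₀), ⟨hs₀, hw₀⟩, hle₀⟩ continuousOn_fst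
    simp only [mem_ofPred_eq, mem_preimage, mem_Iic] at hs hw hle
    have hw0 : w ≠ 0 := by
      rintro rfl
      simp at hw
    have hafter : ∀ r ∈ Ioc s b, ∀ u : Fin n → ℝ, 0 ≤ u ⬝ᵥ (X r).mulVec u := by
      intro r hr u
      rcases eq_or_ne u 0 with rfl | hu0
      · simp
      obtain ⟨c, u, rfl, hu⟩ := exists_smul_dotProduct_self_eq_one hu0
      have : 0 ≤ u ⬝ᵥ (X r).mulVec u := by
        by_contra! hneg
        exact absurd (hmax (show (r, u) ∈ _ from
          ⟨⟨⟨hs.1.trans hr.1.le, hr.2⟩, hu⟩, hneg.le⟩)) (not_le.mpr hr.1)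
      simp only [mulVec_smul, smul_dotProduct, dotProduct_smul, smul_eq_mul]
      nlinarith [mul_nonneg (mul_self_nonneg c) this]
    have hsb : s < b := lt_of_le_of_ne hs.2 fun h => by
      subst h
      exact absurd (hb w hw0) (not_lt.mpr hle)
    have hsub : Ioc s b ⊆ Icc a b := fun r hr => ⟨hs.1.trans hr.1.le, hr.2⟩
    have : (nhdsWithin s (Ioc s b)).NeBot := left_nhdsWithin_Ioc_neBot hsb
    have hpsd : (X s).PosSemidef := by
      refine .of_dotProduct_mulVec_nonneg (by
        rw [IsHermitian, conjTranspose_eq_transpose_of_trivial]; exact hsymm s hs) fun u => ?_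
      exact ge_of_tendsto (((hderiv s hs u).continuousWithinAt).mono hsub)
        (eventually_nhdsWithin_of_forall fun r hr => hafter r hr u)
    have hnonneg := hpsd.dotProduct_mulVec_nonneg w
    rw [star_trivial] at hnonneg
    have hzero := (hpsd.dotProduct_mulVec_zero_iff w).mp (by
      rw [star_trivial]; exact le_antisymm hle hnonneg)
    have hslope := (hasDerivWithinAt_iff_tendsto_slope' (by simp)).mp
      ((hderiv s hs w).mono hsub)
    refine absurd (hker s hs w hw0 hzero) (not_lt.mpr (ge_of_tendsto hslope
      (eventually_nhdsWithin_of_forall fun r hr => ?_)))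
    rw [slope_def_field]
    exact div_nonneg (by linarith [hafter r hr w]) (by linarith [hr.1])
  obtain ⟨c, u, rfl, hu⟩ := exists_smul_dotProduct_self_eq_one hv
  have hc : c ≠ 0 := by
    rintro rfl
    simp at hv
  have : 0 < u ⬝ᵥ (X t).mulVec u := by
    by_contra! hle
    exact key ⟨t, ht, u, hu, hle⟩
  simp only [mulVec_smul, smul_dotProduct, dotProduct_smul, smul_eq_mul]
  have hcc := mul_self_pos.mpr hc
  nlinarith [mul_pos hcc this]

end Bounds

end QuadraticForms

/-- The scalar comparison principle `V' ≤ -c V → V(t) ≤ V(a) exp(-c (t - a))`. -/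
theorem le_mul_exp_of_deriv_le {a b c : ℝ} {V V' : ℝ → ℝ}
    (hV : ∀ t ∈ Icc a b, HasDerivWithinAt V (V' t) (Icc a b) t)
    (hle : ∀ t ∈ Icc a b, V' t ≤ -c * V t) {t : ℝ} (ht : t ∈ Icc a b) :
    V t ≤ V a * Real.exp (-c * (t - a)) := by
  have hW : ∀ s ∈ Icc a b, HasDerivWithinAt (fun s => V s * Real.exp (c * (s - a)))
      (V' s * Real.exp (c * (s - a)) + V s * (Real.exp (c * (s - a)) * (c * 1)))
      (Icc a b) s := fun s hs =>
    (hV s hs).fun_mul ((((hasDerivAt_id s).sub_const a).const_mul c).exp.hasDerivWithinAt)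
  have hanti : AntitoneOn (fun s => V s * Real.exp (c * (s - a))) (Icc a b) :=
    antitoneOn_of_hasDerivWithinAt_nonpos (convex_Icc a b)
      (fun s hs => (hW s hs).continuousWithinAt)
      (fun s hs => (hW s (interior_subset hs)).mono interior_subset) fun s hs => by
        nlinarith [mul_le_mul_of_nonneg_right (hle s (interior_subset hs))
          (Real.exp_pos (c * (s - a))).le]
  have h := hanti (left_mem_Icc.mpr (ht.1.trans ht.2)) ht ht.1
  simp only [sub_self, mul_zero, Real.exp_zero, mul_one] at h
  calc V t = V t * Real.exp (c * (t - a)) * Real.exp (-c * (t - a)) := by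
        rw [mul_assoc, ← Real.exp_add]; simp
    _ ≤ V a * Real.exp (-c * (t - a)) := by gcongr

/-- Summing the coupled Riccati equations gives a Lyapunov equation for the sum. -/
theorem sum_riccati_eq_lyapunov {n M : ℕ} {A : Matrix (Fin n) (Fin n) ℝ}
    {H Q S S' : Fin M → Matrix (Fin n) (Fin n) ℝ}
    (hH : ∀ i, (H i).IsSymm) (hS : ∀ i, (S i).IsSymm)
    (hRic : ∀ i, S' i + S i * A + Aᵀ * S i + Q i + S i * H i * S i
        - ∑ j, (S i * H j * S j + S j * H j * S i) = 0) :
    ∑ i, S' i = -((∑ i, S i) * (A - ∑ j, H j * S j)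
      + (A - ∑ j, H j * S j)ᵀ * (∑ i, S i) + (∑ i, Q i + ∑ i, S i * H i * S i)) := by
  have hsum := Finset.sum_eq_zero fun i (_ : i ∈ Finset.univ) => hRic i
  have hT : (∑ j, H j * S j)ᵀ = ∑ j, S j * H j := by
    simp only [transpose_sum, transpose_mul, (hH _).eq, (hS _).eq]
  have h1 : ∑ i, ∑ j, S i * H j * S j = (∑ i, S i) * ∑ j, H j * S j := by
    simp only [Finset.sum_mul_sum, Matrix.mul_assoc]
  simp only [Finset.sum_sub_distrib, Finset.sum_add_distrib, h1, ← Finset.sum_mul,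
    ← Finset.mul_sum] at hsum
  rw [transpose_sub, hT, Matrix.mul_sub, Matrix.sub_mul, eq_neg_iff_add_eq_zero, ← hsum]
  abel

/-- **Exponential decay bounds in the proof of Theorem 3.**  Under the
positivity hypotheses of Lemma 3, the Lyapunov function `V(t) = x(t)ᵀP(t)x(t)`
of the closed-loop trajectory decays exponentially:
`V(t) ≤ V(t_0) exp(−(λ̲_{Q̂}/λ̄_P)(t−t_0))` and
`‖x(t)‖² ≤ ‖x_0‖² (λ̄_P/λ̲_P) exp(−(λ̲_{Q̂}/λ̄_P)(t−t_0))`, where moreover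
`λ̲_{Q̂} > 0` and `λ̲_P > 0`. -/
theorem aao_exponential_decay {n M : ℕ} [NeZero M] (hn : 1 ≤ n) (hM : 2 ≤ M)
    {t0 tf : ℝ} (ht : t0 < tf)
    (A : ℝ → Matrix (Fin n) (Fin n) ℝ)
    (H Q : Fin M → ℝ → Matrix (Fin n) (Fin n) ℝ)
    (Sf : Fin M → Matrix (Fin n) (Fin n) ℝ)
    (hAcont : ∀ k l, ContinuousOn (fun t => A t k l) (Icc t0 tf))
    (hHcont : ∀ i k l, ContinuousOn (fun t => H i t k l) (Icc t0 tf))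
    (hQcont : ∀ i k l, ContinuousOn (fun t => Q i t k l) (Icc t0 tf))
    (hHpsd : ∀ i, ∀ t ∈ Icc t0 tf, (H i t).PosSemidef)
    (hQ1 : ∀ t ∈ Icc t0 tf, (-(Q 0 t)).PosDef)
    (hQi : ∀ i : Fin M, i ≠ 0 → ∀ t ∈ Icc t0 tf, (Q i t).PosSemidef)
    (hSf1 : (-(Sf 0)).PosDef)
    (hSfi : ∀ i : Fin M, i ≠ 0 → (Sf i).PosSemidef)
    (S S' : Fin M → ℝ → Matrix (Fin n) (Fin n) ℝ)
    (hSsym : ∀ i, ∀ t ∈ Icc t0 tf, (S i t).IsSymm)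
    (hSderiv : ∀ i, ∀ t ∈ Icc t0 tf, ∀ k l,
      HasDerivWithinAt (fun s => S i s k l) (S' i t k l) (Icc t0 tf) t)
    (hS'cont : ∀ i k l, ContinuousOn (fun t => S' i t k l) (Icc t0 tf))
    (hRic : ∀ i, ∀ t ∈ Icc t0 tf,
      S' i t + S i t * A t + (A t)ᵀ * S i t + Q i t + S i t * H i t * S i t
        - ∑ j, (S i t * H j t * S j t + S j t * H j t * S i t) = 0)
    (hterm : ∀ i, S i tf = Sf i)
    (hQsum : ∀ t ∈ Icc t0 tf,
      (Q 0 t + ∑ i ∈ Finset.univ.erase 0, Q i t).PosDef)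
    (hSfsum : (Sf 0 + ∑ i ∈ Finset.univ.erase 0, Sf i).PosDef)
    (lamQhat lamPmax lamPmin : ℝ)
    (hlamQhat : lamQhat = sInf ((fun t => lamMin (∑ i, Q i t)) '' Icc t0 tf))
    (hlamPmax : lamPmax = sSup ((fun t => lamMax (∑ i, S i t)) '' Icc t0 tf))
    (hlamPmin : lamPmin = sInf ((fun t => lamMin (∑ i, S i t)) '' Icc t0 tf))
    (x0 : Fin n → ℝ) (x : ℝ → Fin n → ℝ)
    (hx : ∀ t ∈ Icc t0 tf, ∀ k,
      HasDerivWithinAt (fun s => x s k)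
        (((A t - ∑ j, H j t * S j t).mulVec (x t)) k) (Icc t0 tf) t)
    (hx0 : x t0 = x0) :
    0 < lamQhat ∧ 0 < lamPmin ∧
    ∀ t ∈ Icc t0 tf,
      x t ⬝ᵥ (∑ i, S i t).mulVec (x t)
        ≤ (x t0 ⬝ᵥ (∑ i, S i t0).mulVec (x t0))
            * Real.exp (-(lamQhat / lamPmax) * (t - t0)) ∧
      x t ⬝ᵥ x t
        ≤ (x0 ⬝ᵥ x0) * (lamPmax / lamPmin)
            * Real.exp (-(lamQhat / lamPmax) * (t - t0)) := by
  have hQ : ∀ t ∈ Icc t0 tf, ∀ v : Fin n → ℝ, v ≠ 0 → 0 < v ⬝ᵥ (∑ i, Q i t).mulVec v := by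
    intro t ht v hv
    rw [← Finset.add_sum_erase _ _ (Finset.mem_univ 0)]
    simpa using (hQsum t ht).dotProduct_mulVec_pos hv
  have hHsymm : ∀ t ∈ Icc t0 tf, ∀ i, (H i t).IsSymm := fun t ht i => by
    simpa [IsHermitian, IsSymm, conjTranspose_eq_transpose_of_trivial] using (hHpsd i t ht).isHermitian
  have hLyap := fun t (ht : t ∈ Icc t0 tf) =>
    sum_riccati_eq_lyapunov (hHsymm t ht) (fun i => hSsym i t ht) (fun i => hRic i t ht)
  have hPsymm : ∀ t ∈ Icc t0 tf, (∑ i, S i t).IsSymm := fun t ht => by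
    simp only [IsSymm, transpose_sum, (hSsym _ t ht).eq]
  have hPderiv : ∀ t ∈ Icc t0 tf, ∀ k l, HasDerivWithinAt (fun s => (∑ i, S i s) k l)
      ((∑ i, S' i t) k l) (Icc t0 tf) t := fun t ht k l => by
    simp only [Matrix.sum_apply]
    exact HasDerivWithinAt.fun_sum fun i _ => hSderiv i t ht k l
  have hPcont : ∀ k l, ContinuousOn (fun t => (∑ i, S i t) k l) (Icc t0 tf) := fun k l t ht =>
    (hPderiv t ht k l).continuousWithinAt
  have hQcont' : ∀ k l, ContinuousOn (fun t => (∑ i, Q i t) k l) (Icc t0 tf) := fun k l => by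
    simp only [Matrix.sum_apply]
    exact continuousOn_finsetSum _ fun i _ => hQcont i k l
  have hW : ∀ t ∈ Icc t0 tf, ∀ v : Fin n → ℝ,
      0 ≤ v ⬝ᵥ (∑ i, S i t * H i t * S i t).mulVec v := by
    intro t ht v
    have h := (posSemidef_sum Finset.univ fun i _ =>
      (hHpsd i t ht).conjTranspose_mul_mul_same (S i t)).dotProduct_mulVec_nonneg v
    simpa only [conjTranspose_eq_transpose_of_trivial, (hSsym _ t ht).eq, star_trivial] using h
  have hform : ∀ t ∈ Icc t0 tf, ∀ v : Fin n → ℝ,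
      (A t - ∑ j, H j t * S j t).mulVec v ⬝ᵥ (∑ i, S i t).mulVec v
        + v ⬝ᵥ (∑ i, S' i t).mulVec v
        + v ⬝ᵥ (∑ i, S i t).mulVec ((A t - ∑ j, H j t * S j t).mulVec v)
      = -(v ⬝ᵥ (∑ i, Q i t).mulVec v + v ⬝ᵥ (∑ i, S i t * H i t * S i t).mulVec v) := by
    intro t ht v
    rw [hLyap t ht]
    simp only [neg_mulVec, add_mulVec, dotProduct_neg, dotProduct_add, ← mulVec_mulVec]
    rw [dotProduct_transpose_mulVec, dotProduct_comm (mulVec (∑ i, S i t) v)]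
    ring
  have hP : ∀ t ∈ Icc t0 tf, ∀ v : Fin n → ℝ, v ≠ 0 → 0 < v ⬝ᵥ (∑ i, S i t).mulVec v := by
    intro t ht v hv
    refine quadratic_pos_of_deriv_neg_on_ker (X := fun t => ∑ i, S i t) hPsymm hPderiv
      (fun s hs w hw hker => ?_) (fun w hw => ?_) ht hv
    · have h := hform s hs w
      have hker' : w ⬝ᵥ (∑ i, S i s).mulVec ((A s - ∑ j, H j s * S j s).mulVec w) = 0 := by
        rw [← (hPsymm s hs).eq, dotProduct_transpose_mulVec, hker, dotProduct_zero]
      rw [hker, hker', dotProduct_zero] at h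
      linarith [hQ s hs w hw, hW s hs w]
    · simp only [hterm]
      rw [← Finset.add_sum_erase _ _ (Finset.mem_univ 0)]
      simpa using hSfsum.dotProduct_mulVec_pos hw
  have hlamQ : 0 < lamQhat := hlamQhat ▸ sInf_lamMin_pos hn ht.le hQcont' hQ
  have hlamP : 0 < lamPmin := hlamPmin ▸ sInf_lamMin_pos hn ht.le hPcont hP
  have hQle : ∀ t ∈ Icc t0 tf, ∀ v, lamQhat * (v ⬝ᵥ v) ≤ v ⬝ᵥ (∑ i, Q i t).mulVec v :=
    fun t ht v => hlamQhat ▸ sInf_lamMin_mul_le hn hQcont' ht v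
  have hPle : ∀ t ∈ Icc t0 tf, ∀ v, lamPmin * (v ⬝ᵥ v) ≤ v ⬝ᵥ (∑ i, S i t).mulVec v :=
    fun t ht v => hlamPmin ▸ sInf_lamMin_mul_le hn hPcont ht v
  have hleP : ∀ t ∈ Icc t0 tf, ∀ v, v ⬝ᵥ (∑ i, S i t).mulVec v ≤ lamPmax * (v ⬝ᵥ v) :=
    fun t ht v => hlamPmax ▸ le_sSup_lamMax_mul hn hPcont ht v
  have ht0 : t0 ∈ Icc t0 tf := left_mem_Icc.mpr ht.le
  have hlamPmax_pos : 0 < lamPmax := by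
    obtain ⟨u, hu⟩ := exists_dotProduct_self_eq_one hn
    have h1 := hPle t0 ht0 u
    have h2 := hleP t0 ht0 u
    rw [hu, mul_one] at h1 h2
    linarith
  have hdecay : ∀ t ∈ Icc t0 tf, x t ⬝ᵥ (∑ i, S i t).mulVec (x t)
      ≤ (x t0 ⬝ᵥ (∑ i, S i t0).mulVec (x t0))
        * Real.exp (-(lamQhat / lamPmax) * (t - t0)) := by
    intro t ht
    refine le_mul_exp_of_deriv_le (V := fun t => x t ⬝ᵥ (∑ i, S i t).mulVec (x t))
      (fun s hs => hasDerivWithinAt_quadratic (hPderiv s hs) (hx s hs)) (fun s hs => ?_) ht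
    rw [hform s hs]
    have h1 : lamQhat / lamPmax * (x s ⬝ᵥ (∑ i, S i s).mulVec (x s))
        ≤ lamQhat * (x s ⬝ᵥ x s) :=
      (mul_le_mul_of_nonneg_left (hleP s hs (x s)) (by positivity)).trans_eq (by field_simp)
    linarith [hQle s hs (x s), hW s hs (x s)]
  refine ⟨hlamQ, hlamP, fun t ht => ⟨hdecay t ht, ?_⟩⟩
  subst hx0
  have h1 : lamPmin * (x t ⬝ᵥ x t) ≤ lamPmax * (x t0 ⬝ᵥ x t0)
      * Real.exp (-(lamQhat / lamPmax) * (t - t0)) :=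
    (hPle t ht (x t)).trans ((hdecay t ht).trans
      (mul_le_mul_of_nonneg_right (hleP t0 ht0 (x t0)) (Real.exp_pos _).le))
  calc x t ⬝ᵥ x t = lamPmin * (x t ⬝ᵥ x t) / lamPmin := by field_simp
    _ ≤ lamPmax * (x t0 ⬝ᵥ x t0) * Real.exp (-(lamQhat / lamPmax) * (t - t0)) / lamPmin := by
      gcongr
    _ = _ := by ring
end
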